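/- arXiv:2305.02154 — 3 statements merged into one kernel-verified Lean document; each statement's English description precedes it below -/
import Mathlib

section
/- Let k ≥ 2, n = 2^k − 1, and d, m be positive integers. Let s₁,…,s_d be independent uniform random elements of GL_k(F₂), let ω = (j₁,…,j_{2m}) be a uniformly random word of length 2m over the alphabet {1,…,d}, independent of the matrices, and fix a nonzero v₁ ∈ F₂^k; the word acts by applying alternately s_{j₁}, s_{j₂}⁻¹, s_{j₃}, s_{j₄}⁻¹, …, s_{j_{2m}}⁻¹ to v₁. Let Y₂ be the event that in ω no letter occurs exactly once and at least one letter occurs exactly twice. Define Y_p(c,ℓ,d') recursively by: Y_p(0,0,d') = 1; Y_p(c,ℓ,d') = 0 if p > ℓ (and (c,ℓ) ≠ (0,0)); otherwise Y_p(c,ℓ,d') = Σ_{i=c}^{⌊ℓ/p⌋} C(d',i)·(p!)^{−i}·(ℓ!/(ℓ−pi)!)·Y_{p+1}(0, ℓ−pi, d'−i), and set y₃(i) = Y₃(1, 2m−2i, d−i), y₄(i) = Y₄(0, 2m−2i, d−i). Then P( the walk returns to v₁ and ω ∈ Y₂ ) ≤ (1/d)^{2m}·[ Y₂(1,2m,d)·(2/n)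 + Σ_{i=1}^{m} C(d,i)·(1/2)^i·((2m)!/(2m−2i)!)·(2^i/(i+1)!)·( y₃(i)·(5/n) + y₄(i) ) ]. -/
open scoped BigOperators

/-- The recursively defined quantity `Y_p(c, ℓ, d)` from the statement:
`Y_p(0,0,d) = 1`; `Y_p(c,ℓ,d) = 0` if `p > ℓ` (and `(c,ℓ) ≠ (0,0)`); otherwise
`Y_p(c,ℓ,d) = Σ_{i=c}^{⌊ℓ/p⌋} C(d,i)·(p!)^{−i}·(ℓ!/(ℓ−p·i)!)·Y_{p+1}(0, ℓ−p·i, d−i)`. -/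
noncomputable def Yrec : ℕ → ℕ → ℕ → ℕ → ℝ
  | p, c, l, d =>
    if c = 0 ∧ l = 0 then 1
    else if h : p > l then 0
    else ∑ i ∈ Finset.Icc c (l / p),
      (d.choose i : ℝ) * ((Nat.factorial p : ℝ))⁻¹ ^ i *
        ((Nat.factorial l : ℝ) / (Nat.factorial (l - p * i) : ℝ)) *
        Yrec (p + 1) 0 (l - p * i) (d - i)
termination_by p c l d => l + 1 - p
decreasing_by
  have h1 : l - p * i ≤ l := Nat.sub_le _ _
  omega

/-- The event `Y₂`: no letter occurs exactly once and at least one letter occurs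
exactly twice. -/
def memY2 {L d : ℕ} (ω : Fin L → Fin d) : Prop :=
  (∀ j : Fin d, (Finset.univ.filter fun i : Fin L => ω i = j).card ≠ 1) ∧
    (∃ j : Fin d, (Finset.univ.filter fun i : Fin L => ω i = j).card = 2)

open Module in
theorem exists_linearEquiv_map_linearIndependent {K V : Type*} [Field K] [AddCommGroup V]
    [Module K V] [FiniteDimensional K V] {r : ℕ} {p q : Fin r → V}
    (hp : LinearIndependent K p) (hq : LinearIndependent K q) :
    ∃ g : V ≃ₗ[K] V, ∀ i, g (p i) = q i := by
  let f := hp.linearCombinationEquiv.symm ≪≫ₗ hq.linearCombinationEquiv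
  obtain ⟨g, hg⟩ := Submodule.exists_linearEquiv_restrict_eq f
  refine ⟨g, fun i => ?_⟩
  have h1 : (hp.linearCombinationEquiv (Finsupp.single i 1) : V) = p i := by simp
  have h2 : (hq.linearCombinationEquiv (Finsupp.single i 1) : V) = q i := by simp
  rw [← h1, ← hg, ← h2]
  simp [f]

theorem exists_gl_smul_eq {k r : ℕ} {p q : Fin r → Fin k → ZMod 2}
    (hp : LinearIndependent (ZMod 2) p) (hq : LinearIndependent (ZMod 2) q) :
    ∃ g : GL (Fin k) (ZMod 2), ∀ i, g • p i = q i := by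
  obtain ⟨e, he⟩ := exists_linearEquiv_map_linearIndependent hp hq
  refine ⟨Matrix.GeneralLinearGroup.toLin.symm
    (LinearMap.GeneralLinearGroup.ofLinearEquiv e), fun i => ?_⟩
  rw [← he i, Units.smul_def, Matrix.smul_eq_mulVec, ← Matrix.mulVecLin_apply,
    ← Matrix.GeneralLinearGroup.coe_toLin]
  simp

theorem linearIndependent_gl_smul {k r : ℕ} {p : Fin r → Fin k → ZMod 2}
    (hp : LinearIndependent (ZMod 2) p) (g : GL (Fin k) (ZMod 2)) :
    LinearIndependent (ZMod 2) (fun i => g • p i) := by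
  have h := hp.map' (Matrix.toLin' (g : Matrix (Fin k) (Fin k) (ZMod 2))) (by
    rw [LinearMap.ker_eq_bot]
    intro x y hxy
    simp only [Matrix.toLin'_apply, ← Matrix.smul_eq_mulVec] at hxy
    exact smul_left_cancel g hxy)
  exact h

theorem card_gl_map_tuple_mul_le {k r : ℕ} (hr : r ≤ k) {p : Fin r → Fin k → ZMod 2}
    (hp : LinearIndependent (ZMod 2) p) (q : Fin r → Fin k → ZMod 2) :
    Nat.card {g : GL (Fin k) (ZMod 2) // ∀ i, g • p i = q i} *
      ∏ i : Fin r, (2 ^ k - 2 ^ (i : ℕ)) ≤ Nat.card (GL (Fin k) (ZMod 2)) := by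
  by_cases hq : LinearIndependent (ZMod 2) q
  · have hc := card_linearIndependent (K := ZMod 2) (V := Fin k → ZMod 2) (k := r)
      (by simpa using hr)
    simp only [ZMod.card, Module.finrank_fintype_fun_eq_card, Fintype.card_fin] at hc
    rw [← hc, ← Nat.card_prod]
    choose h hh using fun q' : {s : Fin r → Fin k → ZMod 2 // LinearIndependent (ZMod 2) s} =>
      exists_gl_smul_eq hq q'.2
    refine Nat.card_le_card_of_injective (fun x => h x.2 * x.1.1) ?_
    rintro ⟨⟨g, hg⟩, s⟩ ⟨⟨g', hg'⟩, s'⟩ heq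
    simp only at heq
    have hs : s = s' := by
      ext1
      funext i
      rw [← hh s i, ← hh s' i, ← hg i]
      conv_rhs => rw [hg i, ← hg' i]
      rw [← mul_smul, ← mul_smul, heq]
    subst hs
    simpa using heq
  · have : IsEmpty {g : GL (Fin k) (ZMod 2) // ∀ i, g • p i = q i} := by
      refine ⟨fun g => hq ?_⟩
      have := linearIndependent_gl_smul hp g.1
      simpa only [g.2] using this
    simp

/-- The nonzero vectors of `F₂^k`. -/
abbrev NonzeroVec (k : ℕ) := {v : Fin k → ZMod 2 // v ≠ 0}

instance (k : ℕ) : MulAction (GL (Fin k) (ZMod 2)) (NonzeroVec k) where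
  smul g v := ⟨g • v.1, (smul_ne_zero_iff_ne g).mpr v.2⟩
  one_smul v := Subtype.ext (one_smul _ v.1)
  mul_smul g h v := Subtype.ext (mul_smul g h v.1)

theorem NonzeroVec.coe_smul {k : ℕ} (g : GL (Fin k) (ZMod 2)) (v : NonzeroVec k) :
    ((g • v : NonzeroVec k) : Fin k → ZMod 2) = g • (v : Fin k → ZMod 2) := rfl

theorem NonzeroVec.card (k : ℕ) : Fintype.card (NonzeroVec k) = 2 ^ k - 1 := by
  rw [Fintype.card_subtype_compl]
  simp

open Classical in
/-- The numbers of group elements mapping one, two or three points to prescribed points are at most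
those of the linear group over `F₂` acting on nonzero vectors; `T x y z` stands for the relation
`x + y + z = 0`. -/
structure LinearLike (G X : Type*) [Group G] [Fintype G] [MulAction G X] [Fintype X]
    (T : X → X → X → Prop) : Prop where
  one : ∀ p q : X, (Finset.univ.filter fun g : G => g • p = q).card * Fintype.card X
    ≤ Fintype.card G
  two : ∀ p₁ p₂ q₁ q₂ : X, p₁ ≠ p₂ →
    (Finset.univ.filter fun g : G => g • p₁ = q₁ ∧ g • p₂ = q₂).card *
      (Fintype.card X * (Fintype.card X - 1)) ≤ Fintype.card G
  three : ∀ p₁ p₂ p₃ q₁ q₂ q₃ : X, p₁ ≠ p₂ → p₁ ≠ p₃ → p₂ ≠ p₃ → ¬ T p₁ p₂ p₃ →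
    (Finset.univ.filter fun g : G => g • p₁ = q₁ ∧ g • p₂ = q₂ ∧ g • p₃ = q₃).card *
      (Fintype.card X * (Fintype.card X - 1) * (Fintype.card X - 3)) ≤ Fintype.card G
  map_T : ∀ (g : G) (x y z : X), T x y z → T (g • x) (g • y) (g • z)
  left_unique : ∀ x x' y z, T x y z → T x' y z → x = x'
  mid_unique : ∀ x y y' z, T x y z → T x y' z → y = y'

theorem zmod_two_linearIndependent_pair {V : Type*} [AddCommGroup V] [Module (ZMod 2) V] {a b : V}
    (ha : a ≠ 0) (hb : b ≠ 0) (hab : a ≠ b) : LinearIndependent (ZMod 2) ![a, b] := by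
  rw [LinearIndependent.pair_iff]
  intro s t h
  have h2 : ∀ s : ZMod 2, s = 0 ∨ s = 1 := by decide
  have hn : ∀ x : V, -x = x := fun x => by
    have : (-1 : ZMod 2) = 1 := by decide
    rw [← neg_one_smul (ZMod 2) x, this, one_smul]
  rcases h2 s with rfl | rfl <;> rcases h2 t with rfl | rfl <;> simp_all
  exact hab (by rw [eq_neg_of_add_eq_zero_left h, hn])

theorem zmod_two_linearIndependent_triple {V : Type*} [AddCommGroup V] [Module (ZMod 2) V]
    {a b c : V} (ha : a ≠ 0) (hb : b ≠ 0) (hc : c ≠ 0) (hab : a ≠ b) (hac : a ≠ c) (hbc : b ≠ c)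
    (habc : a + b + c ≠ 0) : LinearIndependent (ZMod 2) ![a, b, c] := by
  rw [Fintype.linearIndependent_iff]
  intro f h
  have h2 : ∀ s : ZMod 2, s = 0 ∨ s = 1 := by decide
  have hn : ∀ x : V, -x = x := fun x => by
    have : (-1 : ZMod 2) = 1 := by decide
    rw [← neg_one_smul (ZMod 2) x, this, one_smul]
  have hne : ∀ x y : V, x + y = 0 → x = y := fun x y h => by
    rw [eq_neg_of_add_eq_zero_left h, hn]
  simp only [Fin.sum_univ_three, Matrix.cons_val] at h
  have key : f 0 = 0 ∧ f 1 = 0 ∧ f 2 = 0 := by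
    rcases h2 (f 0) with h0 | h0 <;> rcases h2 (f 1) with h1 | h1 <;>
      rcases h2 (f 2) with h3 | h3 <;> simp only [h0, h1, h3, zero_smul, one_smul, zero_add,
        add_zero] at h ⊢ <;> first | trivial | (exact absurd h ‹_›) |
        (exact absurd (hne _ _ h) ‹_›)
  intro i
  fin_cases i
  exacts [key.1, key.2.1, key.2.2]

theorem linearLike_nonzeroVec {k : ℕ} (hk : 2 ≤ k) :
    LinearLike (GL (Fin k) (ZMod 2)) (NonzeroVec k)
      (fun x y z => (x + y + z : Fin k → ZMod 2) = 0) where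
  one p q := by
    have h := card_gl_map_tuple_mul_le (k := k) (r := 1) (p := ![p.1]) (by omega)
      (by simpa using p.2) ![q.1]
    rw [NonzeroVec.card, ← Fintype.card_subtype, ← Nat.card_eq_fintype_card,
      ← Nat.card_eq_fintype_card]
    simpa [Subtype.ext_iff, NonzeroVec.coe_smul] using h
  two p₁ p₂ q₁ q₂ hp := by
    have h := card_gl_map_tuple_mul_le (k := k) (r := 2) (p := ![p₁.1, p₂.1]) (by omega)
      (zmod_two_linearIndependent_pair p₁.2 p₂.2 (by simpa [Subtype.ext_iff] using hp))
      ![q₁.1, q₂.1]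
    rw [NonzeroVec.card, ← Fintype.card_subtype, ← Nat.card_eq_fintype_card,
      ← Nat.card_eq_fintype_card]
    simpa [Subtype.ext_iff, NonzeroVec.coe_smul, Fin.forall_fin_two, Fin.prod_univ_two,
      Nat.sub_sub] using h
  three p₁ p₂ p₃ q₁ q₂ q₃ h₁₂ h₁₃ h₂₃ hT := by
    rcases Nat.lt_or_ge k 3 with hk3 | hk3
    · obtain rfl : k = 2 := by omega
      simp
    have h := card_gl_map_tuple_mul_le (k := k) (r := 3) (p := ![p₁.1, p₂.1, p₃.1]) (by omega)
      (zmod_two_linearIndependent_triple p₁.2 p₂.2 p₃.2 (by simpa [Subtype.ext_iff] using h₁₂)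
        (by simpa [Subtype.ext_iff] using h₁₃) (by simpa [Subtype.ext_iff] using h₂₃) hT)
      ![q₁.1, q₂.1, q₃.1]
    rw [NonzeroVec.card, ← Fintype.card_subtype, ← Nat.card_eq_fintype_card,
      ← Nat.card_eq_fintype_card]
    simpa [Subtype.ext_iff, NonzeroVec.coe_smul, Fin.forall_fin_succ, Fin.prod_univ_three,
      Nat.sub_sub] using h
  map_T g x y z h := by
    simp only [NonzeroVec.coe_smul, ← smul_add, h, smul_zero]
  left_unique x x' y z h h' := by
    ext1; rw [add_assoc] at h h'; exact add_right_cancel (h.trans h'.symm)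
  mid_unique x y y' z h h' := by
    ext1; exact add_left_cancel (add_right_cancel (h.trans h'.symm))

theorem card_filter_prod_le_sum {H X τ : Type*} [Fintype H] [Fintype X] [Fintype τ]
    (P : H → X → Prop) (R : τ → H → Prop) [DecidablePred fun y : H × X => P y.1 y.2]
    [∀ t, DecidablePred (R t)] (φ : H → X → τ) (hφ : ∀ g v v', φ g v = φ g v' → v = v')
    (hR : ∀ g v, P g v → R (φ g v) g) :
    (Finset.univ.filter fun y : H × X => P y.1 y.2).card ≤
      ∑ t, (Finset.univ.filter (R t)).card := by
  rw [← Finset.card_sigma]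
  refine Finset.card_le_card_of_injOn (fun y => ⟨φ y.1 y.2, y.1⟩) ?_ ?_
  · rintro ⟨g, v⟩ h
    simpa using hR g v (by simpa using h)
  · rintro ⟨g, v⟩ - ⟨g', v'⟩ - h
    simp only [Sigma.mk.injEq, heq_eq_eq] at h
    obtain ⟨h, rfl⟩ := h
    rw [hφ g v v' h]

/-- `g` or its inverse, according to a sign. -/
def signed {G : Type*} [Group G] (ε : Bool) (g : G) : G := if ε then g else g⁻¹

theorem signed_smul_eq_iff {G X : Type*} [Group G] [MulAction G X] (ε : Bool) (g : G) (a b : X) :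
    signed ε g • a = b ↔ g • (if ε then a else b) = (if ε then b else a) := by
  cases ε
  · simp only [signed, Bool.false_eq_true, if_false]
    rw [inv_smul_eq_iff, eq_comm]
  · simp [signed]

section Counting

open Classical

variable {G X : Type*} [Group G] [Fintype G] [MulAction G X] [Fintype X] {T : X → X → X → Prop}

theorem LinearLike.card_two_le (h : LinearLike G X T) (hX : 2 ≤ Fintype.card X)
    (p₁ p₂ q₁ q₂ : X) :
    ((Finset.univ.filter fun g : G => g • p₁ = q₁ ∧ g • p₂ = q₂).card : ℝ) ≤
      Fintype.card G * ((1 / (Fintype.card X : ℝ)) * (if p₁ = p₂ ∧ q₁ = q₂ then 1 else 0) +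
        (1 / ((Fintype.card X : ℝ) * (Fintype.card X - 1))) *
          (if p₁ ≠ p₂ ∧ q₁ ≠ q₂ then 1 else 0)) := by
  have hn : (2 : ℝ) ≤ Fintype.card X := by exact_mod_cast hX
  have hn1 : (0 : ℝ) < (Fintype.card X : ℝ) * (Fintype.card X - 1) := by nlinarith
  by_cases hp : p₁ = p₂ <;> by_cases hq : q₁ = q₂
  · subst hp; subst hq
    have := h.one p₁ q₁
    simp only [and_self, ite_true, ne_eq, not_true_eq_false, ite_false, mul_zero, add_zero, mul_one]
    rw [mul_one_div, le_div_iff₀ (by linarith)]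
    exact_mod_cast this
  · subst hp
    rw [Finset.filter_false_of_mem (by rintro g - ⟨rfl, h2⟩; exact hq h2)]
    simp [hq]
  · subst hq
    rw [Finset.filter_false_of_mem (by
      rintro g - ⟨rfl, h2⟩; exact hp (smul_left_cancel g h2).symm)]
    simp [hp]
  · have := h.two p₁ p₂ q₁ q₂ hp
    simp only [hp, hq, and_self, ite_true, ne_eq, not_false_eq_true, ite_false, mul_zero, zero_add,
      mul_one]
    rw [mul_one_div, le_div_iff₀ hn1]
    rw [← Nat.cast_le (α := ℝ)] at this
    rw [Nat.cast_mul, Nat.cast_mul, Nat.cast_sub (by omega), Nat.cast_one] at this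
    exact this

theorem LinearLike.card_three_le (h : LinearLike G X T) (hX : 4 ≤ Fintype.card X)
    (p₁ p₂ p₃ q₁ q₂ q₃ : X) :
    ((Finset.univ.filter fun g : G => g • p₁ = q₁ ∧ g • p₂ = q₂ ∧ g • p₃ = q₃).card : ℝ) ≤
      Fintype.card G * ((1 / (Fintype.card X : ℝ)) *
          (if (p₁ = p₂ ∧ q₁ = q₂) ∧ (p₁ = p₃ ∧ q₁ = q₃) ∧ (p₂ = p₃ ∧ q₂ = q₃) then 1 else 0) +
        (1 / ((Fintype.card X : ℝ) * (Fintype.card X - 1))) *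
          ((if p₁ = p₂ ∧ q₁ = q₂ then 1 else 0) + (if p₁ = p₃ ∧ q₁ = q₃ then 1 else 0) +
            (if p₂ = p₃ ∧ q₂ = q₃ then 1 else 0) + (if T p₁ p₂ p₃ ∧ T q₁ q₂ q₃ then 1 else 0)) +
        1 / ((Fintype.card X : ℝ) * (Fintype.card X - 1) * (Fintype.card X - 3))) := by
  have hn : (4 : ℝ) ≤ Fintype.card X := by exact_mod_cast hX
  have hn0 : (0 : ℝ) < (Fintype.card X : ℝ) := by linarith
  have hn1 : (0 : ℝ) < (Fintype.card X : ℝ) * (Fintype.card X - 1) := by nlinarith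
  have hn2 : (0 : ℝ) < (Fintype.card X : ℝ) * (Fintype.card X - 1) * (Fintype.card X - 3) :=
    mul_pos hn1 (by linarith)
  have two : ∀ a b a' b' : X, a ≠ b →
      (Finset.univ.filter fun g : G => g • p₁ = q₁ ∧ g • p₂ = q₂ ∧ g • p₃ = q₃) ⊆
        (Finset.univ.filter fun g : G => g • a = a' ∧ g • b = b') →
      ((Finset.univ.filter fun g : G => g • p₁ = q₁ ∧ g • p₂ = q₂ ∧ g • p₃ = q₃).card : ℝ) ≤
        Fintype.card G * (1 / ((Fintype.card X : ℝ) * (Fintype.card X - 1))) := by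
    intro a b a' b' hab hsub
    have h1 := h.two a b a' b' hab
    rw [← Nat.cast_le (α := ℝ), Nat.cast_mul, Nat.cast_mul, Nat.cast_sub (by omega),
      Nat.cast_one] at h1
    rw [mul_one_div, le_div_iff₀ hn1]
    refine le_trans (mul_le_mul_of_nonneg_right ?_ hn1.le) h1
    exact_mod_cast Finset.card_le_card hsub
  have hz : ∀ (P : Prop) [Decidable P], (0 : ℝ) ≤ if P then 1 else 0 := by
    intro P _; split_ifs <;> norm_num
  by_cases hne : ∃ g : G, g • p₁ = q₁ ∧ g • p₂ = q₂ ∧ g • p₃ = q₃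
  swap
  · rw [Finset.filter_false_of_mem (fun g _ hg => hne ⟨g, hg⟩)]
    simp only [Finset.card_empty, Nat.cast_zero]
    have a1 := hz ((p₁ = p₂ ∧ q₁ = q₂) ∧ (p₁ = p₃ ∧ q₁ = q₃) ∧ (p₂ = p₃ ∧ q₂ = q₃))
    have a2 := hz (p₁ = p₂ ∧ q₁ = q₂)
    have a3 := hz (p₁ = p₃ ∧ q₁ = q₃)
    have a4 := hz (p₂ = p₃ ∧ q₂ = q₃)
    have a5 := hz (T p₁ p₂ p₃ ∧ T q₁ q₂ q₃)
    positivity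
  obtain ⟨g₀, h₁, h₂, h₃⟩ := hne
  have i₁ : p₁ = p₂ → q₁ = q₂ := by rintro rfl; rw [← h₁, ← h₂]
  have i₂ : p₁ = p₃ → q₁ = q₃ := by rintro rfl; rw [← h₁, ← h₃]
  have i₃ : p₂ = p₃ → q₂ = q₃ := by rintro rfl; rw [← h₂, ← h₃]
  have i₄ : T p₁ p₂ p₃ → T q₁ q₂ q₃ := by
    intro hT; rw [← h₁, ← h₂, ← h₃]; exact h.map_T _ _ _ _ hT
  by_cases hall : p₁ = p₂ ∧ p₂ = p₃
  · have h1 := h.one p₁ q₁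
    rw [← Nat.cast_le (α := ℝ), Nat.cast_mul, ← le_div_iff₀ hn0, ← mul_one_div] at h1
    have hsub : ((Finset.univ.filter fun g : G => g • p₁ = q₁ ∧ g • p₂ = q₂ ∧ g • p₃ = q₃).card : ℝ)
        ≤ ((Finset.univ.filter fun g : G => g • p₁ = q₁).card : ℝ) := by
      refine Nat.cast_le.2 (Finset.card_le_card fun g hg => ?_)
      simp only [Finset.mem_filter, Finset.mem_univ, true_and] at hg ⊢
      exact hg.1
    refine (hsub.trans h1).trans (mul_le_mul_of_nonneg_left ?_ (Nat.cast_nonneg _))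
    rw [if_pos ⟨⟨hall.1, i₁ hall.1⟩, ⟨hall.1.trans hall.2, i₂ (hall.1.trans hall.2)⟩,
      hall.2, i₃ hall.2⟩, mul_one, add_assoc]
    have a2 := hz (p₁ = p₂ ∧ q₁ = q₂)
    have a3 := hz (p₁ = p₃ ∧ q₁ = q₃)
    have a4 := hz (p₂ = p₃ ∧ q₂ = q₃)
    have a5 := hz (T p₁ p₂ p₃ ∧ T q₁ q₂ q₃)
    have : 0 ≤ 1 / ((Fintype.card X : ℝ) * (Fintype.card X - 1)) *
          ((if p₁ = p₂ ∧ q₁ = q₂ then 1 else 0) + (if p₁ = p₃ ∧ q₁ = q₃ then 1 else 0) +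
            (if p₂ = p₃ ∧ q₂ = q₃ then 1 else 0) + (if T p₁ p₂ p₃ ∧ T q₁ q₂ q₃ then 1 else 0)) +
        1 / ((Fintype.card X : ℝ) * (Fintype.card X - 1) * (Fintype.card X - 3)) := by positivity
    linarith
  have big : (p₁ = p₂ ∨ p₁ = p₃ ∨ p₂ = p₃ ∨ T p₁ p₂ p₃) →
      (1 : ℝ) ≤ ((if p₁ = p₂ ∧ q₁ = q₂ then 1 else 0) + (if p₁ = p₃ ∧ q₁ = q₃ then 1 else 0) +
            (if p₂ = p₃ ∧ q₂ = q₃ then 1 else 0) + (if T p₁ p₂ p₃ ∧ T q₁ q₂ q₃ then 1 else 0)) := by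
    have a2 := hz (p₁ = p₂ ∧ q₁ = q₂)
    have a3 := hz (p₁ = p₃ ∧ q₁ = q₃)
    have a4 := hz (p₂ = p₃ ∧ q₂ = q₃)
    have a5 := hz (T p₁ p₂ p₃ ∧ T q₁ q₂ q₃)
    rintro (e | e | e | e)
    · rw [if_pos (c := p₁ = p₂ ∧ q₁ = q₂) ⟨e, i₁ e⟩]; linarith
    · rw [if_pos (c := p₁ = p₃ ∧ q₁ = q₃) ⟨e, i₂ e⟩]; linarith
    · rw [if_pos (c := p₂ = p₃ ∧ q₂ = q₃) ⟨e, i₃ e⟩]; linarith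
    · rw [if_pos (c := T p₁ p₂ p₃ ∧ T q₁ q₂ q₃) ⟨e, i₄ e⟩]; linarith
  have a1 := hz ((p₁ = p₂ ∧ q₁ = q₂) ∧ (p₁ = p₃ ∧ q₁ = q₃) ∧ (p₂ = p₃ ∧ q₂ = q₃))
  have b1 : 0 ≤ 1 / ((Fintype.card X : ℝ) * (Fintype.card X - 1) * (Fintype.card X - 3)) :=
    by positivity
  by_cases hdep : p₁ = p₂ ∨ p₁ = p₃ ∨ p₂ = p₃ ∨ T p₁ p₂ p₃
  · have hle : ((Finset.univ.filter fun g : G =>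
        g • p₁ = q₁ ∧ g • p₂ = q₂ ∧ g • p₃ = q₃).card : ℝ) ≤
        Fintype.card G * (1 / ((Fintype.card X : ℝ) * (Fintype.card X - 1))) := by
      by_cases e : p₁ = p₂
      · refine two p₁ p₃ q₁ q₃ (fun e' => hall ⟨e, e.symm.trans e'⟩) fun g hg => ?_
        simp only [Finset.mem_filter, Finset.mem_univ, true_and] at hg ⊢
        exact ⟨hg.1, hg.2.2⟩
      · refine two p₁ p₂ q₁ q₂ e fun g hg => ?_
        simp only [Finset.mem_filter, Finset.mem_univ, true_and] at hg ⊢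
        exact ⟨hg.1, hg.2.1⟩
    refine hle.trans (mul_le_mul_of_nonneg_left ?_ (Nat.cast_nonneg _))
    have c1 := mul_le_mul_of_nonneg_left (big hdep)
      (show 0 ≤ 1 / ((Fintype.card X : ℝ) * (Fintype.card X - 1)) by positivity)
    rw [mul_one] at c1
    have c2 := mul_nonneg (show 0 ≤ 1 / (Fintype.card X : ℝ) by positivity) a1
    linarith
  · push Not at hdep
    have h1 := h.three p₁ p₂ p₃ q₁ q₂ q₃ hdep.1 hdep.2.1 hdep.2.2.1 hdep.2.2.2
    rw [← Nat.cast_le (α := ℝ), Nat.cast_mul, Nat.cast_mul, Nat.cast_mul, Nat.cast_sub (by omega),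
      Nat.cast_sub (by omega), Nat.cast_one, Nat.cast_ofNat, ← le_div_iff₀ hn2, ← mul_one_div] at h1
    refine h1.trans (mul_le_mul_of_nonneg_left ?_ (Nat.cast_nonneg _))
    have a2 := hz (p₁ = p₂ ∧ q₁ = q₂)
    have a3 := hz (p₁ = p₃ ∧ q₁ = q₃)
    have a4 := hz (p₂ = p₃ ∧ q₂ = q₃)
    have a5 := hz (T p₁ p₂ p₃ ∧ T q₁ q₂ q₃)
    refine le_add_of_nonneg_left ?_
    positivity

end Counting

section Words

open Classical

theorem sum_indicator_le_card {τ σ : Type*} [Fintype τ] [Fintype σ] (P : τ → Prop)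
    [DecidablePred P]
    (ψ : τ → σ) (hψ : ∀ t t', P t → P t' → ψ t = ψ t' → t = t') :
    ∑ t, (if P t then (1 : ℝ) else 0) ≤ Fintype.card σ := by
  rw [Finset.sum_boole]
  refine Nat.cast_le.2 (Finset.card_le_card_of_injOn ψ (by simp) ?_)
  intro t ht t' ht' h
  simp only [Finset.coe_filter, Finset.mem_univ, true_and, Set.mem_ofPred_eq] at ht ht'
  exact hψ t t' ht ht' h

theorem sum_indicator_le_card_finset {τ σ : Type*} [Fintype τ] (s : Finset σ) (P : τ → Prop)
    [DecidablePred P]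
    (ψ : τ → σ) (hs : ∀ t, P t → ψ t ∈ s) (hψ : ∀ t t', P t → P t' → ψ t = ψ t' → t = t') :
    ∑ t, (if P t then (1 : ℝ) else 0) ≤ s.card := by
  rw [Finset.sum_boole]
  refine Nat.cast_le.2 (Finset.card_le_card_of_injOn ψ (fun t ht => hs t (by simpa using ht)) ?_)
  intro t ht t' ht' h
  simp only [Finset.coe_filter, Finset.mem_univ, true_and, Set.mem_ofPred_eq] at ht ht'
  exact hψ t t' ht ht' h

theorem card_filter_prod_and {α β : Type*} [Fintype α] [Fintype β] (P : α → Prop) (Q : β → Prop)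
    [DecidablePred P] [DecidablePred Q] [DecidablePred fun y : α × β => P y.1 ∧ Q y.2] :
    (Finset.univ.filter fun y : α × β => P y.1 ∧ Q y.2).card =
      (Finset.univ.filter P).card * (Finset.univ.filter Q).card := by
  rw [← Finset.card_product]
  congr 1
  ext
  simp

variable {G X : Type*} [Group G] [Fintype G] [MulAction G X] [Fintype X] {T : X → X → X → Prop}

theorem card_offDiag_real : ((Finset.univ.offDiag : Finset (X × X)).card : ℝ) =
    (Fintype.card X : ℝ) * (Fintype.card X - 1) := by
  rw [Finset.offDiag_card, Finset.card_univ, Nat.cast_sub (Nat.le_mul_self _), Nat.cast_mul]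
  ring

theorem LinearLike.card_same_sign_le (h : LinearLike G X T) (hX : 2 ≤ Fintype.card X)
    (ε : Bool) (w t : G) :
    ((Finset.univ.filter fun y : G × X =>
      signed ε y.1 • w • signed ε y.1 • y.2 = t • y.2).card : ℝ) ≤ 2 * Fintype.card G := by
  have hn : (2 : ℝ) ≤ Fintype.card X := by exact_mod_cast hX
  set n : ℝ := (Fintype.card X : ℝ) with hndef
  have h1 := card_filter_prod_le_sum (H := G) (X := X) (τ := X × X)
    (fun g u => signed ε g • w • signed ε g • u = t • u)
    (fun z g => signed ε g • z.1 = z.2 ∧ signed ε g • w • z.2 = t • z.1)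
    (fun g u => (u, signed ε g • u)) (fun g v v' hv => (Prod.ext_iff.1 hv).1)
    (fun g u hu => ⟨rfl, hu⟩)
  refine (Nat.cast_le.2 h1).trans ?_
  rw [Nat.cast_sum]
  simp only [signed_smul_eq_iff]
  refine (Finset.sum_le_sum fun z _ => h.card_two_le hX _ _ _ _).trans ?_
  rw [← Finset.mul_sum, Finset.sum_add_distrib, ← Finset.mul_sum, ← Finset.mul_sum, mul_comm]
  refine mul_le_mul_of_nonneg_right ?_ (Nat.cast_nonneg _)
  have b1 := sum_indicator_le_card (τ := X × X) (σ := X)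
    (fun z => (if ε then z.1 else z.2) = (if ε then w • z.2 else t • z.1) ∧
      (if ε then z.2 else z.1) = (if ε then t • z.1 else w • z.2)) (fun z => z.1) (by
      rintro ⟨u, x⟩ ⟨u', x'⟩ h1 h2 rfl
      cases ε <;> simp at h1 h2 ⊢ <;> grind)
  have b2 := sum_indicator_le_card_finset (τ := X × X) (Finset.univ.offDiag : Finset (X × X))
    (fun z => (if ε then z.1 else z.2) ≠ (if ε then w • z.2 else t • z.1) ∧
      (if ε then z.2 else z.1) ≠ (if ε then t • z.1 else w • z.2)) (fun z => (z.1, w • z.2)) (by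
      rintro ⟨u, x⟩ h1
      cases ε <;> simp_all) (by
      rintro ⟨u, x⟩ ⟨u', x'⟩ h1 h2 h3
      simpa using h3)
  rw [card_offDiag_real] at b2
  refine (add_le_add (mul_le_mul_of_nonneg_left b1 (by positivity)) (mul_le_mul_of_nonneg_left b2
    (one_div_nonneg.2 (mul_nonneg (by linarith) (by linarith))))).trans ?_
  rw [← hndef, one_div_mul_cancel (by linarith), one_div_mul_cancel]
  · norm_num
  · exact mul_ne_zero (by linarith) (by linarith)

theorem LinearLike.card_crossing_le (h : LinearLike G X T) (hX : 3 ≤ Fintype.card X)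
    (ε δ : Bool) (w₁ w₂ w₃ t : G) :
    ((Finset.univ.filter fun y : (G × G) × X =>
      signed (!δ) y.1.2 • w₃ • signed (!ε) y.1.1 • w₂ • signed δ y.1.2 • w₁ •
        signed ε y.1.1 • y.2 = t • y.2).card : ℝ) ≤ 2 * (Fintype.card G : ℝ) ^ 2 := by
  have hn : (3 : ℝ) ≤ Fintype.card X := by exact_mod_cast hX
  set n : ℝ := (Fintype.card X : ℝ) with hndef
  have h1 := card_filter_prod_le_sum (H := G × G) (X := X) (τ := X × X × X × X)
    (fun g u => signed (!δ) g.2 • w₃ • signed (!ε) g.1 • w₂ • signed δ g.2 • w₁ •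
        signed ε g.1 • u = t • u)
    (fun z g => (signed ε g.1 • z.1 = z.2.1 ∧ signed (!ε) g.1 • w₂ • z.2.2.1 = z.2.2.2) ∧
      (signed δ g.2 • w₁ • z.2.1 = z.2.2.1 ∧ signed (!δ) g.2 • w₃ • z.2.2.2 = t • z.1))
    (fun g u => (u, signed ε g.1 • u, signed δ g.2 • w₁ • signed ε g.1 • u,
      signed (!ε) g.1 • w₂ • signed δ g.2 • w₁ • signed ε g.1 • u))
    (fun g v v' hv => (Prod.ext_iff.1 hv).1)
    (fun g u hu => ⟨⟨rfl, rfl⟩, rfl, hu⟩)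
  refine (Nat.cast_le.2 h1).trans ?_
  rw [Nat.cast_sum]
  simp only [signed_smul_eq_iff]
  have key : ∀ z : X × X × X × X,
      ((Finset.univ.filter fun g : G × G =>
        (g.1 • (if ε then z.1 else z.2.1) = (if ε then z.2.1 else z.1) ∧
          g.1 • (if (!ε) then w₂ • z.2.2.1 else z.2.2.2) =
            (if (!ε) then z.2.2.2 else w₂ • z.2.2.1)) ∧
        (g.2 • (if δ then w₁ • z.2.1 else z.2.2.1) = (if δ then z.2.2.1 else w₁ • z.2.1) ∧
          g.2 • (if (!δ) then w₃ • z.2.2.2 else t • z.1) =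
            (if (!δ) then t • z.1 else w₃ • z.2.2.2))).card : ℝ) ≤
      (Fintype.card G : ℝ) ^ 2 * (1 / n ^ 2 * (if (z.1 = z.2.2.2 ∧ z.2.1 = w₂ • z.2.2.1) ∧
          (w₁ • z.2.1 = t • z.1 ∧ z.2.2.1 = w₃ • z.2.2.2) then 1 else 0) +
        1 / (n * (n * (n - 1))) * (if (z.1 = z.2.2.2 ∧ z.2.1 = w₂ • z.2.2.1) ∧
          (w₁ • z.2.1 ≠ t • z.1 ∧ z.2.2.1 ≠ w₃ • z.2.2.2) then 1 else 0) +
        1 / (n * (n * (n - 1))) * (if (z.1 ≠ z.2.2.2 ∧ z.2.1 ≠ w₂ • z.2.2.1) ∧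
          (w₁ • z.2.1 = t • z.1 ∧ z.2.2.1 = w₃ • z.2.2.2) then 1 else 0) +
        1 / (n * (n - 1)) ^ 2 * (if (z.1 ≠ z.2.2.2 ∧ z.2.1 ≠ w₂ • z.2.2.1) ∧
          (w₁ • z.2.1 ≠ t • z.1 ∧ z.2.2.1 ≠ w₃ • z.2.2.2) then 1 else 0)) := by
    rintro ⟨u, x, y, z⟩
    rw [card_filter_prod_and (fun g : G =>
        g • (if ε then u else x) = (if ε then x else u) ∧
          g • (if (!ε) then w₂ • y else z) = (if (!ε) then z else w₂ • y))
      (fun g : G => g • (if δ then w₁ • x else y) = (if δ then y else w₁ • x) ∧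
          g • (if (!δ) then w₃ • z else t • u) = (if (!δ) then t • u else w₃ • z)), Nat.cast_mul]
    have c1 := h.card_two_le (by omega) (if ε then u else x)
      (if (!ε) then w₂ • y else z) (if ε then x else u) (if (!ε) then z else w₂ • y)
    have c2 := h.card_two_le (by omega) (if δ then w₁ • x else y)
      (if (!δ) then w₃ • z else t • u) (if δ then y else w₁ • x) (if (!δ) then t • u else w₃ • z)
    have e1 : ((if ε then u else x) = (if (!ε) then w₂ • y else z) ∧
        (if ε then x else u) = (if (!ε) then z else w₂ • y)) ↔ (u = z ∧ x = w₂ • y) := by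
      cases ε <;> simp [and_comm]
    have e2 : ((if ε then u else x) ≠ (if (!ε) then w₂ • y else z) ∧
        (if ε then x else u) ≠ (if (!ε) then z else w₂ • y)) ↔ (u ≠ z ∧ x ≠ w₂ • y) := by
      cases ε <;> simp [and_comm]
    have e3 : ((if δ then w₁ • x else y) = (if (!δ) then w₃ • z else t • u) ∧
        (if δ then y else w₁ • x) = (if (!δ) then t • u else w₃ • z)) ↔
        (w₁ • x = t • u ∧ y = w₃ • z) := by
      cases δ <;> simp [and_comm]
    have e4 : ((if δ then w₁ • x else y) ≠ (if (!δ) then w₃ • z else t • u) ∧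
        (if δ then y else w₁ • x) ≠ (if (!δ) then t • u else w₃ • z)) ↔
        (w₁ • x ≠ t • u ∧ y ≠ w₃ • z) := by
      cases δ <;> simp [and_comm]
    rw [if_congr e1 rfl rfl, if_congr e2 rfl rfl] at c1
    rw [if_congr e3 rfl rfl, if_congr e4 rfl rfl] at c2
    refine (mul_le_mul c1 c2 (Nat.cast_nonneg _) ((Nat.cast_nonneg _).trans c1)).trans (le_of_eq ?_)
    have hand : ∀ (P Q : Prop) [Decidable P] [Decidable Q] [Decidable (P ∧ Q)],
        (if P ∧ Q then (1 : ℝ) else 0) = (if P then 1 else 0) * (if Q then 1 else 0) := by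
      intro P Q _ _ _; by_cases hP : P <;> by_cases hQ : Q <;> simp [hP, hQ]
    dsimp only
    rw [hand (u = z ∧ x = w₂ • y), hand (u = z ∧ x = w₂ • y), hand (u ≠ z ∧ x ≠ w₂ • y),
      hand (u ≠ z ∧ x ≠ w₂ • y), ← hndef]
    have hn0 : n ≠ 0 := by linarith
    have hn1 : n - 1 ≠ 0 := by linarith
    field_simp
    ring
  refine (Finset.sum_le_sum fun z _ => key z).trans ?_
  rw [← Finset.mul_sum, Finset.sum_add_distrib, Finset.sum_add_distrib, Finset.sum_add_distrib,
    ← Finset.mul_sum, ← Finset.mul_sum, ← Finset.mul_sum, ← Finset.mul_sum, mul_comm]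
  refine mul_le_mul_of_nonneg_right ?_ (by positivity)
  have b1 := sum_indicator_le_card (τ := X × X × X × X) (σ := X)
    (fun z => (z.1 = z.2.2.2 ∧ z.2.1 = w₂ • z.2.2.1) ∧
          (w₁ • z.2.1 = t • z.1 ∧ z.2.2.1 = w₃ • z.2.2.2)) (fun z => z.1) (by
      rintro ⟨u, x, y, z⟩ ⟨u', x', y', z'⟩ ⟨⟨h1, h2⟩, h3, h4⟩ ⟨⟨h1', h2'⟩, h3', h4'⟩ h5
      simp_all)
  have b2 := sum_indicator_le_card_finset (τ := X × X × X × X)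
    (Finset.univ.offDiag : Finset (X × X))
    (fun z => (z.1 = z.2.2.2 ∧ z.2.1 = w₂ • z.2.2.1) ∧
          (w₁ • z.2.1 ≠ t • z.1 ∧ z.2.2.1 ≠ w₃ • z.2.2.2)) (fun z => (w₁ • z.2.1, t • z.1)) (by
      rintro ⟨u, x, y, z⟩ ⟨⟨h1, h2⟩, h3, h4⟩
      simpa using h3) (by
      rintro ⟨u, x, y, z⟩ ⟨u', x', y', z'⟩ ⟨⟨h1, h2⟩, h3, h4⟩ ⟨⟨h1', h2'⟩, h3', h4'⟩ h5
      simp_all)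
  have b3 := sum_indicator_le_card_finset (τ := X × X × X × X)
    (Finset.univ.offDiag : Finset (X × X))
    (fun z => (z.1 ≠ z.2.2.2 ∧ z.2.1 ≠ w₂ • z.2.2.1) ∧
          (w₁ • z.2.1 = t • z.1 ∧ z.2.2.1 = w₃ • z.2.2.2)) (fun z => (z.1, z.2.2.2)) (by
      rintro ⟨u, x, y, z⟩ ⟨⟨h1, h2⟩, h3, h4⟩
      simpa using h1) (by
      rintro ⟨u, x, y, z⟩ ⟨u', x', y', z'⟩ ⟨⟨h1, h2⟩, h3, h4⟩ ⟨⟨h1', h2'⟩, h3', h4'⟩ h5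
      simp only [Prod.mk.injEq] at h5 h3 h3' h4 h4' ⊢
      obtain ⟨rfl, rfl⟩ := h5
      exact ⟨rfl, smul_left_cancel w₁ (h3.trans h3'.symm), h4.trans h4'.symm, rfl⟩)
  have b4 := sum_indicator_le_card_finset (τ := X × X × X × X)
    ((Finset.univ.offDiag : Finset (X × X)) ×ˢ (Finset.univ.offDiag : Finset (X × X)))
    (fun z => (z.1 ≠ z.2.2.2 ∧ z.2.1 ≠ w₂ • z.2.2.1) ∧
          (w₁ • z.2.1 ≠ t • z.1 ∧ z.2.2.1 ≠ w₃ • z.2.2.2))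
    (fun z => ((z.1, z.2.2.2), (z.2.1, w₂ • z.2.2.1))) (by
      rintro ⟨u, x, y, z⟩ ⟨⟨h1, h2⟩, h3, h4⟩
      simpa using ⟨h1, h2⟩) (by
      rintro ⟨u, x, y, z⟩ ⟨u', x', y', z'⟩ h1 h2 h5
      simp_all)
  rw [Finset.card_product, Nat.cast_mul] at b4
  rw [card_offDiag_real] at b2 b3 b4
  rw [← hndef] at b1 b2 b3 b4
  have hn0 : 0 < n := by linarith
  have hn1 : 0 < n - 1 := by linarith
  refine (add_le_add (add_le_add (add_le_add (mul_le_mul_of_nonneg_left b1 (by positivity))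
    (mul_le_mul_of_nonneg_left b2 (by positivity))) (mul_le_mul_of_nonneg_left b3 (by positivity)))
    (mul_le_mul_of_nonneg_left b4 (by positivity))).trans ?_
  have : 1 / n ^ 2 * n + 1 / (n * (n * (n - 1))) * (n * (n - 1)) +
      1 / (n * (n * (n - 1))) * (n * (n - 1)) +
      1 / (n * (n - 1)) ^ 2 * (n * (n - 1) * (n * (n - 1))) = 3 / n + 1 := by
    field_simp
    ring
  rw [this]
  have : 3 / n ≤ 1 := by rw [div_le_one hn0]; exact hn
  linarith

theorem LinearLike.card_triple_le (h : LinearLike G X T) (hX : 15 ≤ Fintype.card X)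
    (ε₁ ε₂ ε₃ : Bool) (w₁ w₂ t : G) :
    ((Finset.univ.filter fun y : G × X =>
      signed ε₃ y.1 • w₂ • signed ε₂ y.1 • w₁ • signed ε₁ y.1 • y.2 = t • y.2).card : ℝ) ≤
      7 * Fintype.card G := by
  have hn : (15 : ℝ) ≤ Fintype.card X := by exact_mod_cast hX
  have h1 := card_filter_prod_le_sum (H := G) (X := X) (τ := X × X × X)
    (fun g u => signed ε₃ g • w₂ • signed ε₂ g • w₁ • signed ε₁ g • u = t • u)
    (fun z g => signed ε₁ g • z.1 = z.2.1 ∧ signed ε₂ g • w₁ • z.2.1 = z.2.2 ∧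
      signed ε₃ g • w₂ • z.2.2 = t • z.1)
    (fun g u => (u, signed ε₁ g • u, signed ε₂ g • w₁ • signed ε₁ g • u))
    (fun g v v' hv => (Prod.ext_iff.1 hv).1)
    (fun g u hu => ⟨rfl, rfl, hu⟩)
  refine (Nat.cast_le.2 h1).trans ?_
  rw [Nat.cast_sum]
  simp only [signed_smul_eq_iff]
  refine (Finset.sum_le_sum fun z _ => h.card_three_le (by omega) _ _ _ _ _ _).trans ?_
  rw [← Finset.mul_sum, Finset.sum_add_distrib, Finset.sum_add_distrib, ← Finset.mul_sum,
    ← Finset.mul_sum, Finset.sum_add_distrib, Finset.sum_add_distrib, Finset.sum_add_distrib,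
    mul_comm]
  refine mul_le_mul_of_nonneg_right ?_ (by positivity)
  let p₁ : X × X × X → X := fun z => if ε₁ then z.1 else z.2.1
  let q₁ : X × X × X → X := fun z => if ε₁ then z.2.1 else z.1
  let p₂ : X × X × X → X := fun z => if ε₂ then w₁ • z.2.1 else z.2.2
  let q₂ : X × X × X → X := fun z => if ε₂ then z.2.2 else w₁ • z.2.1
  let p₃ : X × X × X → X := fun z => if ε₃ then w₂ • z.2.2 else t • z.1
  let q₃ : X × X × X → X := fun z => if ε₃ then t • z.1 else w₂ • z.2.2
  have b1 := sum_indicator_le_card (τ := X × X × X) (σ := X)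
    (fun z => (p₁ z = p₂ z ∧ q₁ z = q₂ z) ∧ (p₁ z = p₃ z ∧ q₁ z = q₃ z) ∧
      (p₂ z = p₃ z ∧ q₂ z = q₃ z)) (fun z => z.1) (by
      rintro ⟨u, x, y⟩ ⟨u', x', y'⟩ h1 h2 rfl
      have i1 := @smul_left_cancel G X _ _ w₁ x x'
      have i2 := @smul_left_cancel G X _ _ w₂ y y'
      cases ε₁ <;> cases ε₂ <;> cases ε₃ <;> simp [p₁, p₂, p₃, q₁, q₂, q₃] at h1 h2 ⊢ <;> grind)
  have b2 := sum_indicator_le_card (τ := X × X × X) (σ := X × X)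
    (fun z => p₁ z = p₂ z ∧ q₁ z = q₂ z) (fun z => (z.2.1, z.2.2)) (by
      rintro ⟨u, x, y⟩ ⟨u', x', y'⟩ h1 h2 h3
      cases ε₁ <;> cases ε₂ <;> simp [p₁, p₂, q₁, q₂] at h1 h2 h3 ⊢ <;> grind)
  have b3 := sum_indicator_le_card (τ := X × X × X) (σ := X × X)
    (fun z => p₁ z = p₃ z ∧ q₁ z = q₃ z) (fun z => (z.1, z.2.2)) (by
      rintro ⟨u, x, y⟩ ⟨u', x', y'⟩ h1 h2 h3
      cases ε₁ <;> cases ε₃ <;> simp [p₁, p₃, q₁, q₃] at h1 h2 h3 ⊢ <;> grind)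
  have b4 := sum_indicator_le_card (τ := X × X × X) (σ := X × X)
    (fun z => p₂ z = p₃ z ∧ q₂ z = q₃ z) (fun z => (z.1, z.2.2)) (by
      rintro ⟨u, x, y⟩ ⟨u', x', y'⟩ h1 h2 h3
      have i1 := @smul_left_cancel G X _ _ w₁ x x'
      cases ε₂ <;> cases ε₃ <;> simp [p₂, p₃, q₂, q₃] at h1 h2 h3 ⊢ <;> grind)
  have b5 : ∑ z : X × X × X,
      (if T (p₁ z) (p₂ z) (p₃ z) ∧ T (q₁ z) (q₂ z) (q₃ z) then (1 : ℝ) else 0) ≤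
        Fintype.card (X × X) := by
    refine sum_indicator_le_card (τ := X × X × X) (σ := X × X) _
      (fun z => if ε₁ = ε₃ then (z.2.1, z.2.2) else if ε₁ = ε₂ then (z.1, z.2.2) else
        (z.1, z.2.1)) ?_
    rintro ⟨u, x, y⟩ ⟨u', x', y'⟩ h1 h2 h3
    have l1 := h.left_unique
    have l2 := h.mid_unique
    cases ε₁ <;> cases ε₂ <;> cases ε₃ <;>
      simp [p₁, p₂, p₃, q₁, q₂, q₃] at h1 h2 h3 ⊢ <;> grind
  simp only [Finset.sum_const, Finset.card_univ, nsmul_eq_mul, Fintype.card_prod, Nat.cast_mul]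
    at b2 b3 b4 b5 ⊢
  set n : ℝ := (Fintype.card X : ℝ) with hndef
  have hn0 : 0 < n := by linarith
  have hn1 : 0 < n - 1 := by linarith
  have hn3 : 0 < n - 3 := by linarith
  refine (add_le_add (add_le_add (mul_le_mul_of_nonneg_left b1 (by positivity))
    (mul_le_mul_of_nonneg_left (add_le_add (add_le_add (add_le_add b2 b3) b4) b5)
      (by positivity))) le_rfl).trans ?_
  have : 1 / n * n + 1 / (n * (n - 1)) * (n * n + n * n + n * n + n * n) +
      n * (n * n) * (1 / (n * (n - 1) * (n - 3))) =
      1 + (4 * n * (n - 3) + n ^ 2) / ((n - 1) * (n - 3)) := by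
    field_simp
    ring
  rw [this]
  have : (4 * n * (n - 3) + n ^ 2) / ((n - 1) * (n - 3)) ≤ 6 := by
    rw [div_le_iff₀ (by positivity)]
    nlinarith
  linarith

end Words

/-- The product `g (t - 1) * ⋯ * g 1 * g 0`. -/
def walkProd {G : Type*} [Group G] (g : ℕ → G) : ℕ → G
  | 0 => 1
  | t + 1 => g t * walkProd g t

/-- The product `g (j - 1) * ⋯ * g i`. -/
def walkSeg {G : Type*} [Group G] (g : ℕ → G) (i j : ℕ) : G := walkProd g j * (walkProd g i)⁻¹

theorem walkSeg_congr {G : Type*} [Group G] {g g' : ℕ → G} {i j : ℕ} (hij : i ≤ j)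
    (h : ∀ t, i ≤ t → t < j → g t = g' t) : walkSeg g i j = walkSeg g' i j := by
  induction j, hij using Nat.le_induction with
  | base => simp [walkSeg]
  | succ j hij ih =>
    have := ih fun t h1 h2 => h t h1 (by omega)
    unfold walkSeg at this ⊢
    simp only [walkProd]
    rw [mul_assoc, this, h j hij (by omega), mul_assoc]

theorem walkSeg_eq_seg_mul {G : Type*} [Group G] (g : ℕ → G) (a i L : ℕ) :
    walkSeg g a L = walkSeg g (i + 1) L * g i * walkSeg g a i := by
  simp [walkSeg, walkProd, mul_assoc]

theorem walkSeg_zero {G : Type*} [Group G] (g : ℕ → G) (L : ℕ) :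
    walkSeg g 0 L = walkProd g L := by
  simp [walkSeg, walkProd]

theorem ofFn_reverse_prod_eq_walkProd {G : Type*} [Group G] (g : ℕ → G) (L : ℕ) :
    (List.ofFn fun i : Fin L => g i).reverse.prod = walkProd g L := by
  induction L with
  | zero => simp [walkProd]
  | succ L ih =>
    rw [List.ofFn_succ']
    simp [walkProd, ih]

theorem sum_sum_update {ι G M : Type*} [DecidableEq ι] [Fintype ι] [Fintype G] [AddCommMonoid M]
    (c : ι) (F : (ι → G) → M) :
    ∑ s : ι → G, ∑ g : G, F (Function.update s c g) = Fintype.card G • ∑ s, F s := by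
  have e : ∑ y : (ι → G) × G, F (Function.update y.1 c y.2) = ∑ y : (ι → G) × G, F y.1 := by
    refine Fintype.sum_equiv
      (Function.Involutive.toPerm (fun y : (ι → G) × G => (Function.update y.1 c y.2, y.1 c)) ?_)
      _ _ (fun y => rfl)
    rintro ⟨s, g⟩
    simp
  rw [Fintype.sum_prod_type, Fintype.sum_prod_type] at e
  rw [e, Finset.smul_sum]
  simp

section Walk

open Classical

variable {G X ι : Type*} [Group G] [Fintype G] [MulAction G X] [Fintype X] [Fintype ι]
  [DecidableEq ι]  {T : X → X → X → Prop}

/-- The group element applied by the walk of length `L` determined by the word `ω` with signs `ε`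
and the group elements `s`. -/
def wordProd (ω : ℕ → ι) (ε : ℕ → Bool) (L : ℕ) (s : ι → G) : G :=
  walkProd (fun t => signed (ε t) (s (ω t))) L

theorem walkProd_conj (g : ℕ → G) (a : G) (L : ℕ) :
    walkProd (fun t => a * g t * a⁻¹) L = a * walkProd g L * a⁻¹ := by
  induction L with
  | zero => simp [walkProd]
  | succ L ih => simp [walkProd, ih]

theorem wordProd_conj (ω : ℕ → ι) (ε : ℕ → Bool) (L : ℕ) (s : ι → G) (a : G) :
    wordProd ω ε L (fun j => a * s j * a⁻¹) = a * wordProd ω ε L s * a⁻¹ := by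
  unfold wordProd
  rw [← walkProd_conj]
  congr 1
  funext t
  cases ε t <;> simp [signed, mul_assoc]

theorem card_return_eq [MulAction.IsPretransitive G X] (ω : ℕ → ι) (ε : ℕ → Bool) (L : ℕ)
    (u v : X) :
    (Finset.univ.filter fun s : ι → G => wordProd ω ε L s • u = u).card =
      (Finset.univ.filter fun s : ι → G => wordProd ω ε L s • v = v).card := by
  obtain ⟨a, rfl⟩ := MulAction.exists_smul_eq G v u
  symm
  refine Finset.card_bijective (fun s j => a * s j * a⁻¹) ?_ ?_
  · refine ⟨fun s s' h => ?_, fun s => ⟨fun j => a⁻¹ * s j * a, ?_⟩⟩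
    · funext j
      simpa using congrFun h j
    · funext j
      simp [mul_assoc]
  · intro s
    simp only [Finset.mem_filter, Finset.mem_univ, true_and]
    rw [wordProd_conj, mul_smul, mul_smul, inv_smul_smul]
    simp

theorem card_mul_card_return [MulAction.IsPretransitive G X] (ω : ℕ → ι) (ε : ℕ → Bool) (L : ℕ)
    (v : X) :
    Fintype.card X * (Finset.univ.filter fun s : ι → G => wordProd ω ε L s • v = v).card =
      ∑ s : ι → G, (Finset.univ.filter fun u : X => wordProd ω ε L s • u = u).card := by
  simp only [Finset.card_filter]
  rw [Finset.sum_comm]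
  simp only [← Finset.card_filter]
  rw [Finset.sum_congr rfl fun u _ => card_return_eq ω ε L u v]
  simp

theorem card_pairs_return (F : G → G) [DecidablePred fun y : G × X => F y.1 • y.2 = y.2] :
    ∑ g : G, (Finset.univ.filter fun u : X => F g • u = u).card =
      (Finset.univ.filter fun y : G × X => F y.1 • y.2 = y.2).card := by
  simp only [Finset.card_filter]
  rw [Fintype.sum_prod_type]
  refine Finset.sum_congr rfl fun g _ => Finset.sum_congr rfl fun u _ => ?_
  congr

theorem card_le_of_smul {H : Type*} [Fintype H] (P Q : H → X → Prop)
    [DecidablePred fun y : H × X => P y.1 y.2] [DecidablePred fun y : H × X => Q y.1 y.2]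
    (w : G) (h : ∀ g u, P g u → Q g (w • u)) :
    (Finset.univ.filter fun y : H × X => P y.1 y.2).card ≤
      (Finset.univ.filter fun y : H × X => Q y.1 y.2).card := by
  refine Finset.card_le_card_of_injOn (fun y => (y.1, w • y.2)) ?_ ?_
  · rintro ⟨g, u⟩ hu
    simpa using h g u (by simpa using hu)
  · rintro ⟨g, u⟩ - ⟨g', u'⟩ - h
    simpa using h

theorem signed_update_of_ne {ω : ℕ → ι} {ε : ℕ → Bool} {s : ι → G} {c : ι} {g : G} {t : ℕ}
    (h : ω t ≠ c) : signed (ε t) (Function.update s c g (ω t)) = signed (ε t) (s (ω t)) := by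
  rw [Function.update_of_ne h]

/-- A walk whose word contains a letter exactly twice, with the same sign, returns with probability
at most `2 / n`. -/
theorem LinearLike.card_return_same_sign (h : LinearLike G X T) [MulAction.IsPretransitive G X]
    (hX : 2 ≤ Fintype.card X) {ω : ℕ → ι} {ε : ℕ → Bool} {L i j : ℕ} {c : ι} (hij : i < j)
    (hj : j < L) (hi' : ω i = c) (hj' : ω j = c) (hε : ε i = ε j)
    (hc : ∀ t, t < L → ω t = c → t = i ∨ t = j) (v : X) :
    (Fintype.card X : ℝ) *
      (Finset.univ.filter fun s : ι → G => wordProd ω ε L s • v = v).card ≤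
        2 * Fintype.card (ι → G) := by
  have hG : (0 : ℝ) < Fintype.card G := by exact_mod_cast Fintype.card_pos
  refine le_of_mul_le_mul_left ?_ hG
  have e1 : (Fintype.card G : ℝ) * ((Fintype.card X : ℝ) *
      (Finset.univ.filter fun s : ι → G => wordProd ω ε L s • v = v).card) =
      ∑ s : ι → G, ((Finset.univ.filter fun y : G × X =>
        wordProd ω ε L (Function.update s c y.1) • y.2 = y.2).card : ℝ) := by
    have := sum_sum_update c
      (fun s : ι → G => (Finset.univ.filter fun u : X => wordProd ω ε L s • u = u).card)
    rw [← card_mul_card_return ω ε L v, smul_eq_mul] at this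
    simp only [card_pairs_return] at this
    exact_mod_cast this.symm
  rw [e1]
  have e2 : ∀ s : ι → G, ((Finset.univ.filter fun y : G × X =>
      wordProd ω ε L (Function.update s c y.1) • y.2 = y.2).card : ℝ) ≤ 2 * Fintype.card G := by
    intro s
    let f : ℕ → G := fun t => signed (ε t) (s (ω t))
    refine le_trans (Nat.cast_le.2 ?_) (h.card_same_sign_le hX (ε j) (walkSeg f (i + 1) j)
      ((walkSeg f (j + 1) L)⁻¹ * (walkSeg f 0 i)⁻¹))
    refine card_le_of_smul (H := G) (fun g u => wordProd ω ε L (Function.update s c g) • u = u)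
      (fun g u => signed (ε j) g • walkSeg f (i + 1) j • signed (ε j) g • u =
        ((walkSeg f (j + 1) L)⁻¹ * (walkSeg f 0 i)⁻¹) • u) (walkSeg f 0 i) ?_
    intro g u hu
    have hs : ∀ a b, a ≤ b → b ≤ L → (∀ t, a ≤ t → t < b → t ≠ i ∧ t ≠ j) →
        walkSeg (fun t => signed (ε t) (Function.update s c g (ω t))) a b = walkSeg f a b := by
      intro a b hab hb ht
      refine walkSeg_congr hab fun t h1 h2 => signed_update_of_ne fun hω => ?_
      rcases hc t (by omega) hω with rfl | rfl
      · exact (ht _ h1 h2).1 rfl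
      · exact (ht _ h1 h2).2 rfl
    rw [wordProd, ← walkSeg_zero, walkSeg_eq_seg_mul _ 0 j L, walkSeg_eq_seg_mul _ 0 i j,
      hs _ _ (by omega) (by omega) (by omega), hs _ _ (by omega) (by omega) (by omega),
      hs _ _ (by omega) (by omega) (by omega), hi', hj', Function.update_self, hε] at hu
    rw [mul_smul, inv_smul_smul, eq_inv_smul_iff]
    simpa only [mul_smul] using hu
  refine (Finset.sum_le_sum fun s _ => e2 s).trans (le_of_eq ?_)
  simp
  ring

/-- A walk whose word contains a letter exactly three times returns with probability at most
`7 / n`. -/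
theorem LinearLike.card_return_triple (h : LinearLike G X T) [MulAction.IsPretransitive G X]
    (hX : 15 ≤ Fintype.card X) {ω : ℕ → ι} {ε : ℕ → Bool} {L i j k : ℕ} {c : ι} (hij : i < j)
    (hjk : j < k) (hk : k < L) (hi' : ω i = c) (hj' : ω j = c) (hk' : ω k = c)
    (hc : ∀ t, t < L → ω t = c → t = i ∨ t = j ∨ t = k) (v : X) :
    (Fintype.card X : ℝ) *
      (Finset.univ.filter fun s : ι → G => wordProd ω ε L s • v = v).card ≤
        7 * Fintype.card (ι → G) := by
  have hG : (0 : ℝ) < Fintype.card G := by exact_mod_cast Fintype.card_pos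
  refine le_of_mul_le_mul_left ?_ hG
  have e1 : (Fintype.card G : ℝ) * ((Fintype.card X : ℝ) *
      (Finset.univ.filter fun s : ι → G => wordProd ω ε L s • v = v).card) =
      ∑ s : ι → G, ((Finset.univ.filter fun y : G × X =>
        wordProd ω ε L (Function.update s c y.1) • y.2 = y.2).card : ℝ) := by
    have := sum_sum_update c
      (fun s : ι → G => (Finset.univ.filter fun u : X => wordProd ω ε L s • u = u).card)
    rw [← card_mul_card_return ω ε L v, smul_eq_mul] at this
    simp only [card_pairs_return] at this
    exact_mod_cast this.symm
  rw [e1]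
  have e2 : ∀ s : ι → G, ((Finset.univ.filter fun y : G × X =>
      wordProd ω ε L (Function.update s c y.1) • y.2 = y.2).card : ℝ) ≤ 7 * Fintype.card G := by
    intro s
    let f : ℕ → G := fun t => signed (ε t) (s (ω t))
    refine le_trans (Nat.cast_le.2 ?_) (h.card_triple_le hX (ε i) (ε j) (ε k)
      (walkSeg f (i + 1) j) (walkSeg f (j + 1) k)
      ((walkSeg f (k + 1) L)⁻¹ * (walkSeg f 0 i)⁻¹))
    refine card_le_of_smul (H := G) (fun g u => wordProd ω ε L (Function.update s c g) • u = u)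
      (fun g u => signed (ε k) g • walkSeg f (j + 1) k • signed (ε j) g • walkSeg f (i + 1) j •
        signed (ε i) g • u = ((walkSeg f (k + 1) L)⁻¹ * (walkSeg f 0 i)⁻¹) • u)
      (walkSeg f 0 i) ?_
    intro g u hu
    have hs : ∀ a b, a ≤ b → b ≤ L → (∀ t, a ≤ t → t < b → t ≠ i ∧ t ≠ j ∧ t ≠ k) →
        walkSeg (fun t => signed (ε t) (Function.update s c g (ω t))) a b = walkSeg f a b := by
      intro a b hab hb ht
      refine walkSeg_congr hab fun t h1 h2 => signed_update_of_ne fun hω => ?_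
      rcases hc t (by omega) hω with rfl | rfl | rfl
      · exact (ht _ h1 h2).1 rfl
      · exact (ht _ h1 h2).2.1 rfl
      · exact (ht _ h1 h2).2.2 rfl
    rw [wordProd, ← walkSeg_zero, walkSeg_eq_seg_mul _ 0 k L, walkSeg_eq_seg_mul _ 0 j k,
      walkSeg_eq_seg_mul _ 0 i j,
      hs _ _ (by omega) (by omega) (by omega), hs _ _ (by omega) (by omega) (by omega),
      hs _ _ (by omega) (by omega) (by omega), hs _ _ (by omega) (by omega) (by omega),
      hi', hj', hk', Function.update_self] at hu
    rw [mul_smul, inv_smul_smul, eq_inv_smul_iff]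
    simpa only [mul_smul] using hu
  refine (Finset.sum_le_sum fun s _ => e2 s).trans (le_of_eq ?_)
  simp
  ring

/-- A walk whose word contains two crossing letters, each of them exactly twice with opposite
signs, returns with probability at most `2 / n`. -/
theorem LinearLike.card_return_crossing (h : LinearLike G X T) [MulAction.IsPretransitive G X]
    (hX : 3 ≤ Fintype.card X) {ω : ℕ → ι} {ε : ℕ → Bool} {L i j k l : ℕ} {a b : ι} (hab : a ≠ b)
    (hij : i < j) (hjk : j < k) (hkl : k < l) (hl : l < L) (hi' : ω i = a) (hj' : ω j = b)
    (hk' : ω k = a) (hl' : ω l = b) (hεa : ε k = !ε i) (hεb : ε l = !ε j)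
    (ha : ∀ t, t < L → ω t = a → t = i ∨ t = k) (hb : ∀ t, t < L → ω t = b → t = j ∨ t = l)
    (v : X) :
    (Fintype.card X : ℝ) *
      (Finset.univ.filter fun s : ι → G => wordProd ω ε L s • v = v).card ≤
        2 * Fintype.card (ι → G) := by
  have hG : (0 : ℝ) < (Fintype.card G : ℝ) ^ 2 := by
    have : (0 : ℝ) < Fintype.card G := by exact_mod_cast Fintype.card_pos
    positivity
  refine le_of_mul_le_mul_left ?_ hG
  have e1 : (Fintype.card G : ℝ) ^ 2 * ((Fintype.card X : ℝ) *
      (Finset.univ.filter fun s : ι → G => wordProd ω ε L s • v = v).card) =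
      ∑ s : ι → G, ((Finset.univ.filter fun y : (G × G) × X =>
        wordProd ω ε L (Function.update (Function.update s a y.1.1) b y.1.2) • y.2 =
          y.2).card : ℝ) := by
    let F : (ι → G) → ℕ := fun s => (Finset.univ.filter fun u : X => wordProd ω ε L s • u = u).card
    have h1 := sum_sum_update b F
    have h2 := sum_sum_update a (fun s => ∑ g : G, F (Function.update s b g))
    rw [h1, ← card_mul_card_return ω ε L v, smul_eq_mul, smul_eq_mul] at h2
    have h3 : ∀ s : ι → G, ∑ g : G, ∑ g' : G, F (Function.update (Function.update s a g) b g') =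
        (Finset.univ.filter fun y : (G × G) × X =>
          wordProd ω ε L (Function.update (Function.update s a y.1.1) b y.1.2) • y.2 =
            y.2).card := by
      intro s
      simp only [F, Finset.card_filter]
      rw [Fintype.sum_prod_type, Fintype.sum_prod_type]
    simp only [h3] at h2
    rw [← Nat.cast_sum, h2]
    push_cast
    ring
  rw [e1]
  have e2 : ∀ s : ι → G, ((Finset.univ.filter fun y : (G × G) × X =>
      wordProd ω ε L (Function.update (Function.update s a y.1.1) b y.1.2) • y.2 = y.2).card : ℝ) ≤
        2 * (Fintype.card G : ℝ) ^ 2 := by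
    intro s
    let f : ℕ → G := fun t => signed (ε t) (s (ω t))
    refine le_trans (Nat.cast_le.2 ?_) (h.card_crossing_le hX (ε i) (ε j)
      (walkSeg f (i + 1) j) (walkSeg f (j + 1) k) (walkSeg f (k + 1) l)
      ((walkSeg f (l + 1) L)⁻¹ * (walkSeg f 0 i)⁻¹))
    refine card_le_of_smul (H := G × G)
      (fun g u => wordProd ω ε L (Function.update (Function.update s a g.1) b g.2) • u = u)
      (fun g u => signed (!ε j) g.2 • walkSeg f (k + 1) l • signed (!ε i) g.1 •
        walkSeg f (j + 1) k • signed (ε j) g.2 • walkSeg f (i + 1) j •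
        signed (ε i) g.1 • u = ((walkSeg f (l + 1) L)⁻¹ * (walkSeg f 0 i)⁻¹) • u)
      (walkSeg f 0 i) ?_
    rintro ⟨g, g'⟩ u hu
    have hs : ∀ x y, x ≤ y → y ≤ L → (∀ t, x ≤ t → t < y → t ≠ i ∧ t ≠ j ∧ t ≠ k ∧ t ≠ l) →
        walkSeg (fun t => signed (ε t)
          (Function.update (Function.update s a g) b g' (ω t))) x y = walkSeg f x y := by
      intro x y hxy hy ht
      refine walkSeg_congr hxy fun t h1 h2 => ?_
      have hta : ω t ≠ a := fun hω => by
        rcases ha t (by omega) hω with rfl | rfl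
        · exact (ht _ h1 h2).1 rfl
        · exact (ht _ h1 h2).2.2.1 rfl
      have htb : ω t ≠ b := fun hω => by
        rcases hb t (by omega) hω with rfl | rfl
        · exact (ht _ h1 h2).2.1 rfl
        · exact (ht _ h1 h2).2.2.2 rfl
      rw [signed_update_of_ne htb, signed_update_of_ne hta]
    rw [wordProd, ← walkSeg_zero, walkSeg_eq_seg_mul _ 0 l L, walkSeg_eq_seg_mul _ 0 k l,
      walkSeg_eq_seg_mul _ 0 j k, walkSeg_eq_seg_mul _ 0 i j,
      hs _ _ (by omega) (by omega) (by omega), hs _ _ (by omega) (by omega) (by omega),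
      hs _ _ (by omega) (by omega) (by omega), hs _ _ (by omega) (by omega) (by omega),
      hs _ _ (by omega) (by omega) (by omega),
      hi', hj', hk', hl', Function.update_self, Function.update_of_ne hab, Function.update_self,
      hεa, hεb] at hu
    rw [mul_smul, inv_smul_smul, eq_inv_smul_iff]
    simpa only [mul_smul] using hu
  refine (Finset.sum_le_sum fun s _ => e2 s).trans (le_of_eq ?_)
  simp
  ring

end Walk

section Enumeration

open Finset Nat

variable {α β : Type*} [Fintype α] [Fintype β] [DecidableEq β]

/-- Weighted enumeration of functions by the cardinalities of their fibres, in terms of an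
exponential generating function. -/
theorem sum_prod_card_fiber [DecidableEq α] (w : ℕ → ℝ) :
    ∑ f : α → β, ∏ b, w (univ.filter fun a => f a = b).card =
      (Fintype.card α)! * PowerSeries.coeff (Fintype.card α)
        ((PowerSeries.mk fun c => w c / c !) ^ Fintype.card β) := by
  let ev : MvPolynomial β ℝ →ₗ[ℝ] ℝ :=
    (MvPolynomial.basisMonomials β ℝ).constr ℝ fun k => ∏ b, w (k b)
  have hev : ∀ k : β → ℕ, ev (∏ b, MvPolynomial.X b ^ k b) = ∏ b, w (k b) := by
    intro k
    have : (∏ b, MvPolynomial.X b ^ k b : MvPolynomial β ℝ) =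
        MvPolynomial.basisMonomials β ℝ (Finsupp.equivFunOnFinite.symm k) := by
      rw [MvPolynomial.coe_basisMonomials]
      simp only [MvPolynomial.monomial_eq]
      rw [Finsupp.prod_fintype _ _ (by simp)]
      simp
    rw [this]
    simp only [ev, Module.Basis.constr_basis]
    rfl
  have h1 : (∑ b : β, MvPolynomial.X b : MvPolynomial β ℝ) ^ Fintype.card α =
      ∑ f : α → β, ∏ b, MvPolynomial.X b ^ (univ.filter fun a => f a = b).card := by
    have := Finset.prod_univ_sum (fun _ : α => (univ : Finset β))
      (fun _ b => (MvPolynomial.X b : MvPolynomial β ℝ))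
    simp only [prod_const, Finset.card_univ, Fintype.piFinset_univ] at this
    rw [this]
    refine Finset.sum_congr rfl fun f _ => ?_
    rw [Finset.prod_comp (fun b => (MvPolynomial.X b : MvPolynomial β ℝ)) f]
    refine Finset.prod_subset (subset_univ _) fun b _ hb => ?_
    rw [Finset.card_eq_zero.2, pow_zero]
    ext a
    simp only [mem_filter, mem_univ, true_and, notMem_empty, iff_false]
    rintro rfl
    exact hb (mem_image_of_mem _ (mem_univ _))
  have h2 := congrArg ev h1
  rw [Finset.sum_pow_eq_sum_piAntidiag, map_sum, map_sum] at h2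
  simp only [hev] at h2
  rw [← h2]
  have h3 : ((PowerSeries.mk fun c => w c / c !) ^ Fintype.card β : PowerSeries ℝ) =
      ∏ _b : β, (PowerSeries.mk fun c => w c / c !) := by simp
  rw [h3, PowerSeries.coeff_prod, Finset.mul_sum]
  refine Finset.sum_nbij' (fun k => Finsupp.equivFunOnFinite.symm k) (fun k => k) ?_ ?_ ?_ ?_ ?_
  · intro k hk
    simpa using (Finset.mem_piAntidiag.1 hk).1
  · intro k hk
    simpa using (Finset.mem_finsuppAntidiag.1 hk).1
  · intro k hk
    rfl
  · intro k hk
    ext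
    rfl
  · intro k hk
    have hs := (Finset.mem_piAntidiag.1 hk).1
    have hm := Nat.multinomial_spec univ k
    rw [hs] at hm
    rw [← nsmul_eq_mul, map_nsmul, hev, ← hm, nsmul_eq_mul]
    simp only [PowerSeries.coeff_mk, Finsupp.equivFunOnFinite_symm_apply_apply, prod_div_distrib]
    have : (∏ b, ((k b)! : ℝ)) ≠ 0 :=
      Finset.prod_ne_zero_iff.2 fun b _ => by exact_mod_cast Nat.factorial_ne_zero _
    push_cast
    field_simp

/-- The number of functions all of whose fibres have cardinalities in a prescribed set. -/
theorem card_forall_card_fiber [DecidableEq α] (T : ℕ → Prop) [DecidablePred T] :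
    ((univ.filter fun f : α → β => ∀ b, T (univ.filter fun a => f a = b).card).card : ℝ) =
      (Fintype.card α)! * PowerSeries.coeff (Fintype.card α)
        ((PowerSeries.mk fun c => if T c then (c ! : ℝ)⁻¹ else 0) ^ Fintype.card β) := by
  have := sum_prod_card_fiber (α := α) (β := β) fun c => if T c then 1 else 0
  simp only [ite_div, one_div, zero_div] at this
  rw [← this, Finset.card_filter]
  push_cast
  refine Finset.sum_congr rfl fun f _ => ?_
  rw [Finset.prod_ite_zero]
  simp

/-- The exponential generating function of the set `{0} ∪ {c | p ≤ c}`. -/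
noncomputable def zeroOrGeSeries (p : ℕ) : PowerSeries ℝ :=
  PowerSeries.mk fun c => if c = 0 ∨ p ≤ c then (c ! : ℝ)⁻¹ else 0

theorem zeroOrGeSeries_eq_add {p : ℕ} (hp : 1 ≤ p) :
    zeroOrGeSeries p = PowerSeries.C (p ! : ℝ)⁻¹ * PowerSeries.X ^ p + zeroOrGeSeries (p + 1) := by
  ext c
  rw [map_add, PowerSeries.coeff_C_mul, PowerSeries.coeff_X_pow]
  simp only [zeroOrGeSeries, PowerSeries.coeff_mk]
  rcases lt_trichotomy c p with h | rfl | h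
  · have : ¬ p ≤ c := by omega
    have : ¬ p + 1 ≤ c := by omega
    simp [*, h.ne]
  · simp [show c ≠ 0 by omega]
  · have : p ≤ c := by omega
    have : p + 1 ≤ c := by omega
    simp [*, h.ne']

theorem coeff_zeroOrGeSeries_pow {p : ℕ} (hp : 1 ≤ p) (l d : ℕ) :
    PowerSeries.coeff l (zeroOrGeSeries p ^ d) = ∑ i ∈ range (d + 1), if p * i ≤ l then
      (d.choose i : ℝ) * (p ! : ℝ)⁻¹ ^ i *
        PowerSeries.coeff (l - p * i) (zeroOrGeSeries (p + 1) ^ (d - i)) else 0 := by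
  rw [zeroOrGeSeries_eq_add hp, add_pow, map_sum]
  refine Finset.sum_congr rfl fun i _ => ?_
  rw [mul_pow, ← map_pow, ← pow_mul]
  rw [show (PowerSeries.C ((p ! : ℝ)⁻¹ ^ i) * PowerSeries.X ^ (p * i) *
    zeroOrGeSeries (p + 1) ^ (d - i) * ((d.choose i : ℕ) : PowerSeries ℝ)) =
    PowerSeries.C ((d.choose i : ℝ) * (p ! : ℝ)⁻¹ ^ i) *
      (PowerSeries.X ^ (p * i) * zeroOrGeSeries (p + 1) ^ (d - i)) by
        rw [map_mul, map_natCast]; ring]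
  rw [PowerSeries.coeff_C_mul, PowerSeries.coeff_X_pow_mul']
  split_ifs <;> simp

theorem coeff_zeroOrGeSeries_pow_eq_sum_Icc {p : ℕ} (hp : 1 ≤ p) (l d : ℕ) :
    PowerSeries.coeff l (zeroOrGeSeries p ^ d) = ∑ i ∈ Icc 0 (l / p),
      (d.choose i : ℝ) * (p ! : ℝ)⁻¹ ^ i *
        PowerSeries.coeff (l - p * i) (zeroOrGeSeries (p + 1) ^ (d - i)) := by
  rw [coeff_zeroOrGeSeries_pow hp]
  have key : ∀ i, p * i ≤ l ↔ i ≤ l / p := fun i => by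
    rw [Nat.le_div_iff_mul_le (by omega), mul_comm]
  rw [← Finset.sum_filter]
  refine Finset.sum_subset (fun i hi => ?_) fun i hi hi' => ?_
  · simp only [mem_filter, mem_Icc] at hi ⊢
    exact ⟨by omega, (key i).1 hi.2⟩
  · simp only [mem_filter, mem_Icc, mem_range, key] at hi hi'
    rw [Nat.choose_eq_zero_of_lt (by omega)]
    simp

theorem constantCoeff_zeroOrGeSeries_pow (p d : ℕ) :
    PowerSeries.coeff 0 (zeroOrGeSeries p ^ d) = 1 := by
  have h : PowerSeries.constantCoeff (zeroOrGeSeries p) = 1 := by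
    rw [← PowerSeries.coeff_zero_eq_constantCoeff_apply]
    simp only [zeroOrGeSeries, PowerSeries.coeff_mk]
    simp
  rw [PowerSeries.coeff_zero_eq_constantCoeff_apply, map_pow, h, one_pow]

theorem coeff_zeroOrGeSeries_pow_of_lt {p l : ℕ} (hl : 0 < l) (h : l < p) (d : ℕ) :
    PowerSeries.coeff l (zeroOrGeSeries p ^ d) = 0 := by
  rw [PowerSeries.coeff_pow]
  refine Finset.sum_eq_zero fun k hk => ?_
  obtain ⟨hk, -⟩ := mem_finsuppAntidiag.1 hk
  obtain ⟨i, hi, hne⟩ := Finset.exists_ne_zero_of_sum_ne_zero (hk.trans_ne hl.ne')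
  refine Finset.prod_eq_zero hi ?_
  have : k i ≤ l := hk ▸ Finset.single_le_sum (f := fun i => k i) (fun _ _ => Nat.zero_le _) hi
  have : ¬ p ≤ k i := by omega
  simp [zeroOrGeSeries, *]

theorem Yrec_zero {p : ℕ} (hp : 1 ≤ p) (l d : ℕ) :
    Yrec p 0 l d = l ! * PowerSeries.coeff l (zeroOrGeSeries p ^ d) := by
  induction h : l + 1 - p using Nat.strong_induction_on generalizing p l d with
  | _ N ih =>
    rw [Yrec]
    split_ifs with h1 h2
    · obtain ⟨-, rfl⟩ := h1
      simp only [constantCoeff_zeroOrGeSeries_pow]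
      simp
    · rw [coeff_zeroOrGeSeries_pow_of_lt (by simp at h1; omega) h2, mul_zero]
    · rw [coeff_zeroOrGeSeries_pow_eq_sum_Icc hp, Finset.mul_sum]
      refine Finset.sum_congr rfl fun i _ => ?_
      have := Nat.sub_le l (p * i)
      rw [ih (l - p * i + 1 - (p + 1)) (by omega) (by omega) _ _ rfl]
      have : ((l - p * i)! : ℝ) ≠ 0 := by exact_mod_cast Nat.factorial_ne_zero _
      field_simp

theorem Yrec_one {p : ℕ} (hp : 1 ≤ p) (l d : ℕ) :
    Yrec p 1 l d = l ! * (PowerSeries.coeff l (zeroOrGeSeries p ^ d) -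
      PowerSeries.coeff l (zeroOrGeSeries (p + 1) ^ d)) := by
  rw [Yrec]
  rw [if_neg (by simp)]
  split_ifs with h2
  · rcases Nat.eq_zero_or_pos l with rfl | hl
    · simp only [constantCoeff_zeroOrGeSeries_pow]
      simp
    · rw [coeff_zeroOrGeSeries_pow_of_lt hl h2, coeff_zeroOrGeSeries_pow_of_lt hl (by omega)]
      simp
  · rw [coeff_zeroOrGeSeries_pow_eq_sum_Icc hp, ← Finset.add_sum_Ioc_eq_sum_Icc (Nat.zero_le _)]
    rw [show Ioc 0 (l / p) = Icc 1 (l / p) from rfl]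
    simp only [choose_zero_right, cast_one, pow_zero, mul_one, mul_zero, Nat.sub_zero, one_mul]
    rw [add_sub_cancel_left, Finset.mul_sum]
    refine Finset.sum_congr rfl fun i _ => ?_
    rw [Yrec_zero (by omega)]
    have : ((l - p * i)! : ℝ) ≠ 0 := by exact_mod_cast Nat.factorial_ne_zero _
    field_simp

theorem Yrec_zero_eq_card [DecidableEq α] {p : ℕ} (hp : 1 ≤ p) :
    Yrec p 0 (Fintype.card α) (Fintype.card β) =
      (univ.filter fun f : α → β => ∀ b, (univ.filter fun a => f a = b).card = 0 ∨
        p ≤ (univ.filter fun a => f a = b).card).card := by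
  rw [Yrec_zero hp, card_forall_card_fiber fun c => c = 0 ∨ p ≤ c]
  rfl

theorem Yrec_one_eq_card [DecidableEq α] {p : ℕ} (hp : 1 ≤ p) :
    Yrec p 1 (Fintype.card α) (Fintype.card β) =
      (univ.filter fun f : α → β => (∀ b, (univ.filter fun a => f a = b).card = 0 ∨
        p ≤ (univ.filter fun a => f a = b).card) ∧
          ∃ b, (univ.filter fun a => f a = b).card = p).card := by
  have h1 := Yrec_zero_eq_card (α := α) (β := β) hp
  have h2 := Yrec_zero_eq_card (α := α) (β := β) (p := p + 1) (by omega)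
  rw [Yrec_zero (by omega)] at h1 h2
  rw [Yrec_one hp, mul_sub, h1, h2, sub_eq_iff_eq_add]
  norm_cast
  rw [← Finset.card_union_of_disjoint]
  · congr 1
    ext f
    simp only [mem_filter, mem_univ, true_and, mem_union]
    constructor
    · intro h
      by_cases he : ∃ b, (univ.filter fun a => f a = b).card = p
      · exact Or.inl ⟨h, he⟩
      · push Not at he
        refine Or.inr fun b => ?_
        have := h b
        have := he b
        omega
    · rintro (h | h)
      · exact h.1
      · intro b
        have := h b
        omega
  · rw [Finset.disjoint_left]
    intro f hf hf'
    simp only [mem_filter, mem_univ, true_and] at hf hf'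
    obtain ⟨b, hb⟩ := hf.2
    have := hf' b
    omega

end Enumeration

section Noncrossing

open Finset Nat

variable {β : Type*} [Fintype β] [DecidableEq β] {L : ℕ}

/-- Every letter occurs exactly twice in the word `f`. -/
def IsPairing (f : Fin L → β) : Prop := ∀ b, (univ.filter fun t => f t = b).card = 2

/-- No two letters of the word `f` interlace. -/
def IsNoncrossing (f : Fin L → β) : Prop :=
  ∀ p q r s : Fin L, p < q → q < r → r < s → f p = f r → f q = f s → f p = f q

/-- The position `t` is the first occurrence of its letter in the word `f`. -/
def IsOpener (f : Fin L → β) (t : Fin L) : Prop := ∀ s < t, f s ≠ f t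

instance (f : Fin L → β) : DecidablePred (IsOpener f) := fun t => by
  unfold IsOpener; infer_instance

theorem IsPairing.eq_of_eq {f : Fin L → β} (hf : IsPairing f) {a b c : Fin L} (hab : a ≠ b)
    (h1 : f a = f b) (h2 : f b = f c) : c = a ∨ c = b := by
  by_contra! h
  have h3 : ({a, b, c} : Finset (Fin L)).card ≤ (univ.filter fun t => f t = f c).card :=
    card_le_card fun x hx => by
      simp only [mem_insert, mem_singleton] at hx
      rcases hx with rfl | rfl | rfl <;> simp [h1, h2]
  rw [hf, card_eq_three.2 ⟨a, b, c, hab, h.1.symm, h.2.symm, rfl⟩] at h3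
  omega

theorem IsPairing.exists_partner {f : Fin L → β} (hf : IsPairing f) (t : Fin L) :
    ∃ u, u ≠ t ∧ f u = f t := by
  obtain ⟨u, hu, hne⟩ := exists_mem_ne (by rw [hf (f t)]; omega) t
  exact ⟨u, hne, by simpa using hu⟩

theorem IsPairing.exists_opener {f : Fin L → β} (hf : IsPairing f) (b : β) :
    ∃ t, f t = b ∧ IsOpener f t := by
  have hne : (univ.filter fun t => f t = b).Nonempty := by
    rw [← card_pos, hf]; omega
  have hmem := min'_mem _ hne
  simp only [mem_filter, mem_univ, true_and] at hmem
  refine ⟨_, hmem, fun s hs he => ?_⟩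
  exact absurd (min'_le _ s (by simp [he, hmem])) (not_le.2 hs)

theorem IsOpener.eq_of_eq {f : Fin L → β} {s t : Fin L} (hs : IsOpener f s) (ht : IsOpener f t)
    (h : f s = f t) : s = t := by
  rcases lt_trichotomy s t with h1 | h1 | h1
  · exact absurd h (ht s h1)
  · exact h1
  · exact absurd h.symm (hs t h1)

theorem IsPairing.card_opener {f : Fin L → β} (hf : IsPairing f) :
    (univ.filter fun t => IsOpener f t).card = Fintype.card β := by
  rw [← Finset.card_univ]
  refine card_nbij f (fun _ _ => mem_univ _) (fun s hs t ht h => ?_) fun b _ => ?_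
  · exact IsOpener.eq_of_eq (by simpa using hs) (by simpa using ht) h
  · obtain ⟨t, ht, ho⟩ := hf.exists_opener b
    exact ⟨t, by simpa using ho, ht⟩

theorem IsPairing.card_closer_le {f : Fin L → β} (hf : IsPairing f) (j : ℕ) :
    (univ.filter fun t : Fin L => (t : ℕ) < j ∧ ¬ IsOpener f t).card ≤
      (univ.filter fun t : Fin L => (t : ℕ) < j ∧ IsOpener f t).card := by
  choose g hg hfg using hf.exists_partner
  have hlt : ∀ t, ¬ IsOpener f t → g t < t := by
    intro t ht
    simp only [IsOpener, not_forall, not_not] at ht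
    obtain ⟨u, hu, he⟩ := ht
    rcases hf.eq_of_eq hu.ne he (hfg t).symm with h | h
    · rwa [h]
    · exact absurd h (hg t)
  refine card_le_card_of_injOn g ?_ ?_
  · intro t ht
    simp only [coe_filter, mem_univ, true_and, Set.mem_ofPred_eq] at ht ⊢
    have := hlt t ht.2
    refine ⟨lt_trans (by exact_mod_cast this) ht.1, fun s hs he => ?_⟩
    rcases hf.eq_of_eq (hg t) (hfg t) (c := s) (by rw [he, hfg]) with h | h
    · exact hs.ne h
    · exact (hs.trans this).ne h
  · intro s hs t ht h
    simp only [coe_filter, mem_univ, true_and, Set.mem_ofPred_eq] at hs ht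
    by_contra hne
    rcases hf.eq_of_eq (hg s) (hfg s) (c := t) (by rw [← hfg s, h, hfg]) with h' | h'
    · exact hg t (h ▸ h'.symm)
    · exact hne h'.symm

/-- The Dyck step at position `t`: up at first occurrences of letters, down otherwise. -/
def dyckStepAt (f : Fin L → β) (t : ℕ) : DyckStep :=
  if ∃ h : t < L, IsOpener f ⟨t, h⟩ then DyckStep.U else DyckStep.D

theorem count_map_range {γ : Type*} [DecidableEq γ] (g : ℕ → γ) (x : γ) (j : ℕ) :
    ((List.range j).map g).count x = ((range j).filter fun t => g t = x).card := by
  induction j with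
  | zero => simp
  | succ j ih =>
    rw [List.range_succ, List.map_append, List.count_append, ih, range_add_one, filter_insert]
    by_cases h : g j = x
    · rw [if_pos h, card_insert_of_notMem (by simp)]
      simp [h]
    · simp [h]

theorem card_filter_range_eq {P : ℕ → Prop} [DecidablePred P] {Q : Fin L → Prop} [DecidablePred Q]
    {j : ℕ} (hj : j ≤ L) (h : ∀ t : Fin L, P t ↔ Q t) :
    ((range j).filter P).card = (univ.filter fun t : Fin L => (t : ℕ) < j ∧ Q t).card := by
  symm
  refine card_nbij (fun t => (t : ℕ)) ?_ ?_ ?_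
  · intro t ht
    simp only [coe_filter, mem_univ, true_and, mem_range, Set.mem_ofPred_eq] at ht ⊢
    exact ⟨ht.1, (h t).2 ht.2⟩
  · intro s _ t _ hst
    exact Fin.ext hst
  · intro t ht
    simp only [coe_filter, mem_range, Set.mem_ofPred_eq] at ht
    refine ⟨⟨t, by omega⟩, ?_, rfl⟩
    simp only [coe_filter, mem_univ, true_and, Set.mem_ofPred_eq]
    exact ⟨ht.1, (h _).1 ht.2⟩

theorem count_U_dyckStepAt (f : Fin L → β) {j : ℕ} (hj : j ≤ L) :
    ((List.range j).map (dyckStepAt f)).count DyckStep.U =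
      (univ.filter fun t : Fin L => (t : ℕ) < j ∧ IsOpener f t).card := by
  rw [count_map_range]
  refine card_filter_range_eq hj fun t => ?_
  simp [dyckStepAt]

theorem count_D_dyckStepAt (f : Fin L → β) {j : ℕ} (hj : j ≤ L) :
    ((List.range j).map (dyckStepAt f)).count DyckStep.D =
      (univ.filter fun t : Fin L => (t : ℕ) < j ∧ ¬ IsOpener f t).card := by
  rw [count_map_range]
  refine card_filter_range_eq hj fun t => ?_
  simp [dyckStepAt]

theorem IsPairing.count_U {f : Fin L → β} (hf : IsPairing f) :
    ((List.range L).map (dyckStepAt f)).count DyckStep.U = Fintype.card β := by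
  rw [count_U_dyckStepAt f le_rfl, ← hf.card_opener]
  simp

/-- The Dyck word recording the first occurrences of letters in a word in which every letter occurs
twice. -/
def IsPairing.toDyckWord {f : Fin L → β} (hf : IsPairing f) (hL : L = 2 * Fintype.card β) :
    DyckWord where
  toList := (List.range L).map (dyckStepAt f)
  count_U_eq_count_D := by
    have h1 := hf.count_U
    have h2 := count_D_dyckStepAt f le_rfl
    have h3 := hf.card_opener
    have h4 := card_filter_add_card_filter_not (s := (univ : Finset (Fin L))) (IsOpener f)
    simp only [Fin.is_lt, true_and, Finset.card_univ, Fintype.card_fin] at h2 h4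
    rw [h1, h2]
    have h5 : (univ.filter fun t => IsOpener f t).card = (univ.filter (IsOpener f)).card := rfl
    omega
  count_D_le_count_U j := by
    rw [← List.map_take, List.take_range, count_U_dyckStepAt f (min_le_right _ _),
      count_D_dyckStepAt f (min_le_right _ _)]
    exact hf.card_closer_le _

/-- The number of letters whose first occurrence precedes every occurrence of `b`. -/
def openerRank (f : Fin L → β) (b : β) : ℕ :=
  (univ.filter fun t => IsOpener f t ∧ ∀ s, f s = b → t < s).card

theorem openerRank_eq {f : Fin L → β} {t : Fin L} (ht : IsOpener f t) :
    openerRank f (f t) = (univ.filter fun s => IsOpener f s ∧ s < t).card := by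
  unfold openerRank
  congr 1
  ext s
  simp only [mem_filter, mem_univ, true_and, and_congr_right_iff]
  refine fun _ => ⟨fun h => h t rfl, fun h u hu => ?_⟩
  by_contra hle
  exact ht u (lt_of_le_of_lt (not_lt.1 hle) h) hu

theorem openerRank_lt_openerRank {f : Fin L → β} {s t : Fin L} (hs : IsOpener f s)
    (ht : IsOpener f t) (h : s < t) : openerRank f (f s) < openerRank f (f t) := by
  rw [openerRank_eq hs, openerRank_eq ht]
  refine card_lt_card ⟨fun u hu => ?_, fun hsub => ?_⟩
  · simp only [mem_filter, mem_univ, true_and] at hu ⊢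
    exact ⟨hu.1, hu.2.trans h⟩
  · have := @hsub s (by simp [hs, h])
    simp at this

theorem IsPairing.openerRank_injective {f : Fin L → β} (hf : IsPairing f) :
    Function.Injective (openerRank f) := by
  intro b c h
  obtain ⟨s, rfl, hs⟩ := hf.exists_opener b
  obtain ⟨t, rfl, ht⟩ := hf.exists_opener c
  rcases lt_trichotomy s t with h1 | h1 | h1
  · exact absurd h (openerRank_lt_openerRank hs ht h1).ne
  · rw [h1]
  · exact absurd h (openerRank_lt_openerRank ht hs h1).ne'

theorem IsPairing.openerRank_lt {f : Fin L → β} (hf : IsPairing f) (b : β) :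
    openerRank f b < Fintype.card β := by
  obtain ⟨s, rfl, hs⟩ := hf.exists_opener b
  rw [openerRank_eq hs, ← hf.card_opener]
  refine card_lt_card ⟨fun u hu => ?_, fun hsub => ?_⟩
  · simp only [mem_filter, mem_univ, true_and] at hu ⊢
    exact hu.1
  · have := @hsub s (by simp [hs])
    simp at this

theorem IsPairing.not_lt_of_agree {f f' : Fin L → β} (hf : IsPairing f) (hn : IsNoncrossing f)
    (hf' : IsPairing f') {t u u' : Fin L} (h : ∀ s < t, f s = f' s) (hu : f u = f t)
    (hu' : f' u' = f' t) (hut' : u' < t) : ¬ u < u' := by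
  intro huu
  have hne : f u ≠ f u' := fun he => by
    rcases hf.eq_of_eq huu.ne he (c := t) (by rw [← he, hu]) with h | h
    · exact (huu.trans hut').ne' h
    · exact hut'.ne' h
  obtain ⟨w, hw, hfw⟩ := hf.exists_partner u'
  rcases lt_trichotomy w t with hwt | rfl | hwt
  · have : f' u' = f' w := by rw [← h _ hut', ← h _ hwt, hfw]
    rcases hf'.eq_of_eq hw.symm this (c := t) (by rw [← this, hu']) with h | h
    · exact hut'.ne' h
    · exact hwt.ne' h
  · exact hne (hu.trans hfw)
  · exact hne (hn u u' t w huu hut' hwt hu hfw.symm)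

theorem IsPairing.eq_of_isOpener_iff {f f' : Fin L → β} (hf : IsPairing f) (hn : IsNoncrossing f)
    (hf' : IsPairing f') (hn' : IsNoncrossing f') (ho : ∀ t, IsOpener f t ↔ IsOpener f' t)
    (hr : openerRank f = openerRank f') : f = f' := by
  have key : ∀ N : ℕ, ∀ t : Fin L, (t : ℕ) = N → f t = f' t := by
    intro N
    induction N using Nat.strong_induction_on with
    | _ N ih =>
      rintro t rfl
      have h : ∀ s < t, f s = f' s := fun s hs => ih s (by exact_mod_cast hs) s rfl
      by_cases hop : IsOpener f t
      · refine hf.openerRank_injective ?_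
        conv_rhs => rw [hr]
        rw [openerRank_eq hop, openerRank_eq ((ho t).1 hop)]
        simp only [ho]
      · have hop' := mt (ho t).2 hop
        simp only [IsOpener, not_forall, not_not] at hop hop'
        obtain ⟨u, hu, hfu⟩ := hop
        obtain ⟨u', hu', hfu'⟩ := hop'
        have h1 := hf.not_lt_of_agree hn hf' h hfu hfu' hu'
        have h2 := hf'.not_lt_of_agree hn' hf (fun s hs => (h s hs).symm) hfu' hfu hu
        have : u = u' := le_antisymm (not_lt.1 h2) (not_lt.1 h1)
        rw [← hfu, ← hfu', ← this, h u hu]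
  exact funext fun t => key t t rfl

open Classical in
/-- The number of noncrossing words in which each of `r` letters occurs exactly twice. -/
theorem card_noncrossing_le (hL : L = 2 * Fintype.card β) :
    (univ.filter fun f : Fin L → β => IsPairing f ∧ IsNoncrossing f).card ≤
      catalan (Fintype.card β) * (Fintype.card β)! := by
  rw [← Fintype.card_subtype, ← DyckWord.card_dyckWord_semilength_eq_catalan]
  have hc : (Fintype.card β)! = Fintype.card (β ↪ Fin (Fintype.card β)) := by
    rw [Fintype.card_embedding_eq, Fintype.card_fin, Nat.descFactorial_self]
  rw [hc, ← Fintype.card_prod]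
  refine Fintype.card_le_of_injective (fun f => (⟨f.2.1.toDyckWord hL, f.2.1.count_U⟩,
    ⟨fun b => ⟨openerRank f.1 b, f.2.1.openerRank_lt b⟩, fun b c h =>
      f.2.1.openerRank_injective (by simpa using h)⟩)) ?_
  rintro ⟨f, hf, hn⟩ ⟨f', hf', hn'⟩ h
  rw [Prod.mk.injEq] at h
  refine Subtype.ext (hf.eq_of_isOpener_iff hn hf' hn' (fun t => ?_) ?_)
  · have h1 := congrArg (fun p => p.1.toList) h.1
    simp only [IsPairing.toDyckWord] at h1
    have h2 := List.map_inj_left.1 h1 t (by simp)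
    simp only [dyckStepAt, Fin.is_lt, exists_true_left, Fin.eta] at h2
    by_cases ha : IsOpener f t <;> by_cases hb : IsOpener f' t <;> simp_all
  · funext b
    exact congrArg Fin.val (DFunLike.congr_fun h.2 b)

theorem catalan_mul_factorial (i : ℕ) :
    (catalan i * i ! : ℝ) = (2 * i)! / (i + 1)! := by
  have h1 := succ_mul_catalan_eq_centralBinom i
  have h2 := Nat.centralBinom_eq_two_mul_choose i
  have h3 := Nat.choose_mul_factorial_mul_factorial (show i ≤ 2 * i by omega)
  rw [show 2 * i - i = i by omega, ← h2, ← h1] at h3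
  rw [eq_div_iff (by exact_mod_cast Nat.factorial_ne_zero _), ← h3, Nat.factorial_succ]
  push_cast
  ring

end Noncrossing

section Splitting

open Finset Nat

variable {β : Type*} [Fintype β] [DecidableEq β] {L : ℕ}

/-- The number of occurrences of the letter `b` in the word `f`. -/
def occ {α β : Type*} [Fintype α] [DecidableEq β] (f : α → β) (b : β) : ℕ :=
  (univ.filter fun t => f t = b).card

/-- The letters occurring exactly twice. -/
def doubleLetters (ω : Fin L → β) : Finset β := univ.filter fun b => occ ω b = 2

/-- The positions of the letters occurring exactly twice. -/
def doublePositions (ω : Fin L → β) : Finset (Fin L) := univ.filter fun t => ω t ∈ doubleLetters ω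

/-- No two letters occurring exactly twice in the word interlace. -/
def DoubleNoncrossing (ω : Fin L → β) : Prop :=
  ∀ p q r s : Fin L, p < q → q < r → r < s → ω p = ω r → ω q = ω s →
    occ ω (ω p) = 2 → occ ω (ω q) = 2 → ω p = ω q

theorem mem_doubleLetters {ω : Fin L → β} {b : β} : b ∈ doubleLetters ω ↔ occ ω b = 2 := by
  simp [doubleLetters]

theorem mem_doublePositions {ω : Fin L → β} {t : Fin L} :
    t ∈ doublePositions ω ↔ ω t ∈ doubleLetters ω := by
  simp [doublePositions]

theorem card_doublePositions (ω : Fin L → β) :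
    (doublePositions ω).card = 2 * (doubleLetters ω).card := by
  rw [card_eq_sum_card_fiberwise (f := ω) (t := doubleLetters ω)
    fun t ht => by simpa [doublePositions] using ht]
  rw [Finset.sum_const_nat (m := 2), mul_comm]
  intro b hb
  rw [← mem_doubleLetters.1 hb, occ]
  congr 1
  ext t
  simp only [doublePositions, mem_filter, mem_univ, true_and, and_iff_right_iff_imp]
  rintro rfl
  exact hb

theorem occ_comp_eq {α α' γ : Type*} [Fintype α] [Fintype α'] [DecidableEq γ]
    {f : α → β} {e : α' → α} (he : Function.Injective e) {g : α' → γ} {c : γ} {b : β}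
    (h : ∀ x, g x = c ↔ f (e x) = b) (hs : ∀ t, f t = b → ∃ x, e x = t) : occ g c = occ f b := by
  unfold occ
  refine card_nbij e ?_ he.injOn ?_
  · intro x hx
    simp only [coe_filter, mem_univ, true_and, Set.mem_ofPred_eq] at hx ⊢
    exact (h x).1 hx
  · intro t ht
    simp only [coe_filter, mem_univ, true_and, Set.mem_ofPred_eq] at ht
    obtain ⟨x, rfl⟩ := hs t ht
    exact ⟨x, by simpa using (h x).2 ht, rfl⟩

open Classical in
/-- Words with a given set `A` of letters occurring exactly twice and a given set `S` of positions
of these letters split into a word on `S` and a word on the complement of `S`. -/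
theorem card_split_le (A : Finset β) (S : Finset (Fin L)) (hS : S.card = 2 * A.card)
    (W : ({b // b ∉ A} → ℕ) → Prop) :
    (univ.filter fun ω : Fin L → β => (doubleLetters ω = A ∧ doublePositions ω = S) ∧
      DoubleNoncrossing ω ∧ W fun b => occ ω b).card ≤
    (univ.filter fun f : Fin (2 * A.card) → A => IsPairing f ∧ IsNoncrossing f).card *
      (univ.filter fun g : {t // t ∉ S} → {b // b ∉ A} => W fun b => occ g b).card := by
  rw [← Fintype.card_subtype, ← Fintype.card_subtype, ← Fintype.card_subtype, ← Fintype.card_prod]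
  let e : Fin (2 * A.card) ↪o Fin L := S.orderEmbOfFin hS
  have he : ∀ x, e x ∈ S := fun x => S.orderEmbOfFin_mem hS x
  have he' : ∀ t ∈ S, ∃ x, e x = t := fun t ht => by
    have := S.range_orderEmbOfFin hS
    exact (this.symm ▸ ht : t ∈ Set.range (S.orderEmbOfFin hS))
  have hm : ∀ {ω : Fin L → β}, doubleLetters ω = A ∧ doublePositions ω = S →
      ∀ t, ω t ∈ A ↔ t ∈ S := by
    rintro ω ⟨rfl, rfl⟩ t
    exact mem_doublePositions.symm
  have hfst : ∀ {ω : Fin L → β} (h : doubleLetters ω = A ∧ doublePositions ω = S)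
      (b : A), occ (fun x => (⟨ω (e x), (hm h _).2 (he x)⟩ : A)) b = occ ω b := by
    intro ω h b
    refine occ_comp_eq e.injective (fun x => Subtype.ext_iff) fun t ht => ?_
    exact he' t ((hm h t).1 (ht ▸ b.2))
  have hsnd : ∀ {ω : Fin L → β} (h : doubleLetters ω = A ∧ doublePositions ω = S)
      (b : {b // b ∉ A}), occ (fun t : {t // t ∉ S} =>
        (⟨ω t, fun hA => t.2 ((hm h _).1 hA)⟩ : {b // b ∉ A})) b = occ ω b := by
    intro ω h b
    refine occ_comp_eq Subtype.val_injective (fun x => Subtype.ext_iff) fun t ht => ?_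
    exact ⟨⟨t, fun hS => b.2 (ht ▸ (hm h t).2 hS)⟩, rfl⟩
  refine Fintype.card_le_of_injective (fun ω =>
    (⟨fun x => ⟨ω.1 (e x), (hm ω.2.1 _).2 (he x)⟩, ?_, ?_⟩,
      ⟨fun t => ⟨ω.1 t, fun hA => t.2 ((hm ω.2.1 _).1 hA)⟩, ?_⟩)) ?_
  · intro b
    have h1 : b.1 ∈ doubleLetters ω.1 := ω.2.1.1.symm ▸ b.2
    exact (hfst ω.2.1 b).trans (mem_doubleLetters.1 h1)
  · intro p q r s hpq hqr hrs h1 h2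
    refine Subtype.ext (ω.2.2.1 (e p) (e q) (e r) (e s) (e.lt_iff_lt.2 hpq) (e.lt_iff_lt.2 hqr)
      (e.lt_iff_lt.2 hrs) (Subtype.ext_iff.1 h1) (Subtype.ext_iff.1 h2) ?_ ?_)
    · exact mem_doubleLetters.1 (ω.2.1.1.symm ▸ (hm ω.2.1 _).2 (he p))
    · exact mem_doubleLetters.1 (ω.2.1.1.symm ▸ (hm ω.2.1 _).2 (he q))
  · have := ω.2.2.2
    simp only [← hsnd ω.2.1] at this
    exact this
  · rintro ⟨ω, hω⟩ ⟨ω', hω'⟩ h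
    rw [Prod.mk.injEq] at h
    refine Subtype.ext (funext fun t => ?_)
    by_cases ht : t ∈ S
    · obtain ⟨x, rfl⟩ := he' t ht
      exact congrArg (fun f => (f.1 x).1) h.1
    · exact congrArg (fun f => (f.1 ⟨t, ht⟩).1) h.2

open Classical in
/-- Enumeration of words in which the letters occurring exactly twice do not interlace. -/
theorem card_doubleNoncrossing_le {m : ℕ} (W : ∀ A : Finset β, ({b // b ∉ A} → ℕ) → Prop)
    (y : ℕ → ℝ)
    (hy : ∀ (A : Finset β) (S : Finset (Fin (2 * m))), S.card = 2 * A.card →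
      ((univ.filter fun g : {t // t ∉ S} → {b // b ∉ A} => W A fun b => occ g b).card : ℝ) =
        y A.card)
    (Ω : Finset (Fin (2 * m) → β)) (hΩ : ∀ ω ∈ Ω, (doubleLetters ω).Nonempty ∧
      DoubleNoncrossing ω ∧ W (doubleLetters ω) fun b => occ ω b) :
    (Ω.card : ℝ) ≤ ∑ i ∈ Icc 1 m, ((Fintype.card β).choose i : ℝ) * ((1 : ℝ) / 2) ^ i *
      ((2 * m)! / (2 * m - 2 * i)! : ℝ) * ((2 : ℝ) ^ i / (i + 1)!) * y i := by
  rw [card_eq_sum_card_fiberwise (f := fun ω => (doubleLetters ω).card) (t := Icc 1 m)]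
  swap
  · intro ω hω
    have h1 := card_pos.2 (hΩ ω hω).1
    have h2 := card_doublePositions ω
    have h3 := card_le_univ (doublePositions ω)
    rw [Fintype.card_fin] at h3
    simp only [coe_Icc, Set.mem_Icc]
    omega
  push_cast
  refine Finset.sum_le_sum fun i hi => ?_
  have him : i ≤ m := (mem_Icc.1 hi).2
  rw [card_eq_sum_card_fiberwise (f := fun ω => (doubleLetters ω, doublePositions ω))
    (t := powersetCard i univ ×ˢ powersetCard (2 * i) univ)]
  swap
  · intro ω hω
    simp only [coe_filter, Set.mem_ofPred_eq] at hω
    simp [card_doublePositions, hω.2]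
  push_cast
  have hB : ∀ x ∈ (powersetCard i univ : Finset (Finset β)) ×ˢ
      (powersetCard (2 * i) univ : Finset (Finset (Fin (2 * m)))),
      ((((Ω.filter fun ω => (doubleLetters ω).card = i)).filter fun ω =>
        (doubleLetters ω, doublePositions ω) = x).card : ℝ) ≤ (2 * i)! / (i + 1)! * y i := by
    rintro ⟨A, S⟩ hx
    simp only [mem_product, mem_powersetCard_univ] at hx
    obtain ⟨hA, hS⟩ := hx
    have hS' : S.card = 2 * A.card := by omega
    have h1 := card_split_le A S hS' (W A)
    have h2 := card_noncrossing_le (β := A) (L := 2 * A.card) (by simp)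
    rw [Fintype.card_coe, hA] at h2
    have h3 := hy A S hS'
    rw [hA] at h3
    rw [← catalan_mul_factorial, ← h3]
    norm_cast
    refine le_trans (card_le_card ?_) (h1.trans (Nat.mul_le_mul_right _ ?_))
    · intro ω hω
      simp only [mem_filter, Prod.mk.injEq, mem_univ, true_and] at hω ⊢
      obtain ⟨⟨h, -⟩, rfl, rfl⟩ := hω
      exact ⟨⟨rfl, rfl⟩, (hΩ ω h).2⟩
    · rw [hA]
      convert h2
  refine (Finset.sum_le_card_nsmul _ _ _ hB).trans_eq ?_
  rw [card_product, card_powersetCard, card_powersetCard, Finset.card_univ, Finset.card_univ,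
    Fintype.card_fin, nsmul_eq_mul]
  have h := Nat.choose_mul_factorial_mul_factorial (show 2 * i ≤ 2 * m by omega)
  have hf : ((2 * m - 2 * i)! : ℝ) ≠ 0 := by exact_mod_cast Nat.factorial_ne_zero _
  have hf' : ((i + 1)! : ℝ) ≠ 0 := by exact_mod_cast Nat.factorial_ne_zero _
  rw [← h]
  push_cast
  rw [div_pow, one_pow]
  field_simp

end Splitting

section Return

open Finset

instance (k : ℕ) : MulAction.IsPretransitive (GL (Fin k) (ZMod 2)) (NonzeroVec k) where
  exists_smul_eq x y := by
    obtain ⟨g, hg⟩ := exists_gl_smul_eq (p := ![x.1]) (q := ![y.1]) (by simpa using x.2)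
      (by simpa using y.2)
    exact ⟨g, Subtype.ext (hg 0)⟩

/-- The extension of a finite word by a constant letter. -/
def extendWord {ι : Type*} {L : ℕ} (c : ι) (ω : Fin L → ι) (t : ℕ) : ι :=
  if h : t < L then ω ⟨t, h⟩ else c

theorem extendWord_coe {ι : Type*} {L : ℕ} (c : ι) (ω : Fin L → ι) (t : Fin L) :
    extendWord c ω t = ω t := by
  simp [extendWord]

theorem forall_extendWord {ι : Type*} {L : ℕ} {c a : ι} {ω : Fin L → ι} {P : ℕ → Prop}
    (h : ∀ t : Fin L, ω t = a → P t) : ∀ t, t < L → extendWord c ω t = a → P t := by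
  intro t ht hω
  refine h ⟨t, ht⟩ ?_
  simpa [extendWord, ht] using hω

theorem eq_or_eq_of_occ_eq_two {α β : Type*} [Fintype α] [DecidableEq β] {f : α → β} {p r : α}
    (hpr : p ≠ r) (h : f p = f r) (ho : occ f (f p) = 2) (t : α) (ht : f t = f p) :
    t = p ∨ t = r := by
  classical
  have : ({p, r} : Finset α) = univ.filter fun t => f t = f p := by
    refine eq_of_subset_of_card_le ?_ ?_
    · intro x hx
      simp only [mem_insert, mem_singleton] at hx
      rcases hx with rfl | rfl <;> simp [h]
    · rw [card_pair hpr]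
      exact ho.le
  have hmem : t ∈ ({p, r} : Finset α) := by rw [this]; simpa using ht
  simpa using hmem

theorem exists_lt_lt_of_occ_eq_three {L : ℕ} {β : Type*} [DecidableEq β] {f : Fin L → β} {b : β}
    (ho : occ f b = 3) : ∃ i j k : Fin L, i < j ∧ j < k ∧ f i = b ∧ f j = b ∧ f k = b ∧
      ∀ t, f t = b → t = i ∨ t = j ∨ t = k := by
  have hmem : ∀ t, t ∈ (univ.filter fun t => f t = b) ↔ f t = b := by simp
  let e := (univ.filter fun t => f t = b).orderEmbOfFin ho
  have he : ∀ x, f (e x) = b := fun x => (hmem _).1 (orderEmbOfFin_mem _ ho x)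
  refine ⟨e 0, e 1, e 2, e.lt_iff_lt.2 (by decide), e.lt_iff_lt.2 (by decide), he 0, he 1, he 2,
    fun t ht => ?_⟩
  have hr : t ∈ Set.range e := by
    have := range_orderEmbOfFin (univ.filter fun t => f t = b) ho
    rw [this]
    exact_mod_cast (hmem t).2 ht
  obtain ⟨x, rfl⟩ := hr
  fin_cases x <;> simp

variable {G X ι : Type*} [Group G] [Fintype G] [MulAction G X] [Fintype X] [Fintype ι]
  [DecidableEq ι] {T : X → X → X → Prop} {L : ℕ}

open Classical in
/-- A walk whose word contains two interlacing letters occurring exactly twice returns with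
probability at most `2 / n`. -/
theorem LinearLike.card_return_of_not_doubleNoncrossing (h : LinearLike G X T)
    [MulAction.IsPretransitive G X] (hX : 3 ≤ Fintype.card X) (c : ι) {ω : Fin L → ι}
    (ε : ℕ → Bool) (hω : ¬ DoubleNoncrossing ω) (v : X) :
    (Fintype.card X : ℝ) * (Finset.univ.filter fun s : ι → G =>
      wordProd (extendWord c ω) ε L s • v = v).card ≤ 2 * Fintype.card (ι → G) := by
  simp only [DoubleNoncrossing, not_forall] at hω
  obtain ⟨p, q, r, s, hpq, hqr, hrs, hpr', hqs', hp, hq, hne⟩ := hω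
  have ha := forall_extendWord (c := c) (P := fun t => t = p ∨ t = r)
    fun t ht => by simpa [Fin.ext_iff] using
      eq_or_eq_of_occ_eq_two (hpq.trans hqr).ne hpr' hp t ht
  have hb := forall_extendWord (c := c) (P := fun t => t = q ∨ t = s)
    fun t ht => by simpa [Fin.ext_iff] using
      eq_or_eq_of_occ_eq_two (hqr.trans hrs).ne hqs' hq t ht
  have h1 := extendWord_coe c ω
  by_cases hεp : ε p = ε r
  · exact h.card_return_same_sign (by omega) (hpq.trans hqr) r.2 (h1 p) ((h1 r).trans hpr'.symm)
      hεp ha v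
  by_cases hεq : ε q = ε s
  · exact h.card_return_same_sign (by omega) (hqr.trans hrs) s.2 (h1 q) ((h1 s).trans hqs'.symm)
      hεq hb v
  · exact h.card_return_crossing hX hne hpq hqr hrs s.2 (h1 p) (h1 q) ((h1 r).trans hpr'.symm)
      ((h1 s).trans hqs'.symm) (Bool.eq_not.2 (Ne.symm hεp)) (Bool.eq_not.2 (Ne.symm hεq)) ha hb v

open Classical in
/-- A walk whose word contains a letter occurring exactly three times returns with probability at
most `7 / n`. -/
theorem LinearLike.card_return_of_occ_eq_three (h : LinearLike G X T)
    [MulAction.IsPretransitive G X] (hX : 15 ≤ Fintype.card X) (c : ι) {ω : Fin L → ι}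
    (ε : ℕ → Bool) {b : ι} (hb : occ ω b = 3) (v : X) :
    (Fintype.card X : ℝ) * (Finset.univ.filter fun s : ι → G =>
      wordProd (extendWord c ω) ε L s • v = v).card ≤ 7 * Fintype.card (ι → G) := by
  obtain ⟨i, j, k, hij, hjk, hi, hj, hk, hall⟩ := exists_lt_lt_of_occ_eq_three hb
  have h1 := extendWord_coe c ω
  exact h.card_return_triple hX hij hjk k.2 ((h1 i).trans hi) ((h1 j).trans hj) ((h1 k).trans hk)
    (forall_extendWord (P := fun t => t = i ∨ t = j ∨ t = k) fun t ht => by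
      simpa [Fin.ext_iff] using hall t ht) v

theorem LinearLike.card_return_le (h : LinearLike G X T) [MulAction.IsPretransitive G X]
    (hX : 3 ≤ Fintype.card X) (hX' : Fintype.card X ≤ 7 ∨ 15 ≤ Fintype.card X) (c : ι)
    (ω : Fin L → ι) (ε : ℕ → Bool) (v : X) {P Q : Prop} [Decidable P]
    [Decidable Q] (hP : DoubleNoncrossing ω → (∃ b, occ ω b = 3) → P)
    (hQ : DoubleNoncrossing ω → (¬ ∃ b, occ ω b = 3) → Q) :
    (Fintype.card X : ℝ) *
      Nat.card {s : ι → G // wordProd (extendWord c ω) ε L s • v = v} ≤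
      (2 + ((if P then 5 else 0) + if Q then (Fintype.card X : ℝ) else 0)) *
        (Nat.card G : ℝ) ^ Fintype.card ι := by
  classical
  have hc : (Nat.card G : ℝ) ^ Fintype.card ι = Fintype.card (ι → G) := by
    rw [Fintype.card_fun, Nat.card_eq_fintype_card, Nat.cast_pow]
  rw [hc, Nat.card_eq_fintype_card, Fintype.card_subtype]
  have htriv : ((Finset.univ.filter fun s : ι → G =>
      wordProd (extendWord c ω) ε L s • v = v).card : ℝ) ≤ Fintype.card (ι → G) := by
    exact_mod_cast card_le_univ _
  have hP0 : (0 : ℝ) ≤ if P then 5 else 0 := by positivity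
  have hQ0 : (0 : ℝ) ≤ if Q then (Fintype.card X : ℝ) else 0 := by positivity
  by_cases hω : DoubleNoncrossing ω
  · by_cases h3 : ∃ b, occ ω b = 3
    · rw [if_pos (hP hω h3)]
      refine le_trans ?_ (mul_le_mul_of_nonneg_right (show (7 : ℝ) ≤ _ by linarith)
        (Nat.cast_nonneg _))
      rcases hX' with h7 | h15
      · exact mul_le_mul (by exact_mod_cast h7) htriv (by positivity) (by norm_num)
      · obtain ⟨b, hb⟩ := h3
        exact h.card_return_of_occ_eq_three h15 c ε hb v
    · rw [if_pos (hQ hω h3)]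
      exact mul_le_mul (by linarith) htriv (by positivity) (by positivity)
  · refine (h.card_return_of_not_doubleNoncrossing hX c ε hω v).trans
      (mul_le_mul_of_nonneg_right (by linarith) (Nat.cast_nonneg _))

end Return

section Assembly

open Finset

theorem card_filter_univ_congr {α : Type*} [Fintype α] {p q : α → Prop} {hp : DecidablePred p}
    {hq : DecidablePred q} (h : ∀ a, p a ↔ q a) :
    (univ.filter p).card = (univ.filter q).card := by
  simp only [h]

theorem Yrec_two_one_eq_card {d L : ℕ} [DecidablePred (memY2 : (Fin L → Fin d) → Prop)] :
    Yrec 2 1 L d = (univ.filter fun ω : Fin L → Fin d => memY2 ω).card := by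
  have h := Yrec_one_eq_card (α := Fin L) (β := Fin d) (p := 2) (by omega)
  simp only [Fintype.card_fin] at h
  rw [h, Nat.cast_inj]
  refine card_filter_univ_congr fun ω => and_congr (forall_congr' fun b => ?_) Iff.rfl
  omega

theorem memY2.doubleLetters_nonempty {d L : ℕ} {ω : Fin L → Fin d} (h : memY2 ω) :
    (doubleLetters ω).Nonempty := by
  obtain ⟨b, hb⟩ := h.2
  exact ⟨b, mem_doubleLetters.2 hb⟩

theorem memY2.occ_eq_zero_or {d L : ℕ} {ω : Fin L → Fin d} (h : memY2 ω) {b : Fin d}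
    (hb : b ∉ doubleLetters ω) : occ ω b = 0 ∨ 3 ≤ occ ω b := by
  have h1 : occ ω b ≠ 1 := h.1 b
  rw [mem_doubleLetters] at hb
  omega

theorem card_notMem_finset {α : Type*} [Fintype α] [DecidableEq α] (S : Finset α) :
    Fintype.card {t // t ∉ S} = Fintype.card α - S.card := by
  rw [Fintype.card_subtype_compl, Fintype.card_coe]

open Classical in
theorem card_doubleNoncrossing_three_le {d m : ℕ} :
    ((univ.filter fun ω : Fin (2 * m) → Fin d =>
      memY2 ω ∧ DoubleNoncrossing ω ∧ ∃ b, occ ω b = 3).card : ℝ) ≤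
    ∑ i ∈ Icc 1 m, (d.choose i : ℝ) * ((1 : ℝ) / 2) ^ i *
      ((Nat.factorial (2 * m) : ℝ) / (Nat.factorial (2 * m - 2 * i) : ℝ)) *
      ((2 : ℝ) ^ i / (Nat.factorial (i + 1) : ℝ)) * Yrec 3 1 (2 * m - 2 * i) (d - i) := by
  refine le_of_le_of_eq (card_doubleNoncrossing_le (β := Fin d)
    (W := fun A k => (∀ b, k b = 0 ∨ 3 ≤ k b) ∧ ∃ b, k b = 3)
    (fun i => Yrec 3 1 (2 * m - 2 * i) (d - i)) ?_ _ ?_) (by rw [Fintype.card_fin])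
  · intro A S hS
    have h := Yrec_one_eq_card (α := {t // t ∉ S}) (β := {b // b ∉ A}) (p := 3) (by omega)
    simp only [card_notMem_finset, Fintype.card_fin, hS] at h
    rw [h, Nat.cast_inj]
    exact card_filter_univ_congr fun g => Iff.rfl
  · intro ω hω
    simp only [mem_filter, mem_univ, true_and] at hω
    obtain ⟨hY, hN, b, hb⟩ := hω
    refine ⟨hY.doubleLetters_nonempty, hN, fun b => hY.occ_eq_zero_or b.2, ⟨b, ?_⟩, hb⟩
    rw [mem_doubleLetters]
    omega

open Classical in
theorem card_doubleNoncrossing_not_three_le {d m : ℕ} :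
    ((univ.filter fun ω : Fin (2 * m) → Fin d =>
      memY2 ω ∧ DoubleNoncrossing ω ∧ ¬ ∃ b, occ ω b = 3).card : ℝ) ≤
    ∑ i ∈ Icc 1 m, (d.choose i : ℝ) * ((1 : ℝ) / 2) ^ i *
      ((Nat.factorial (2 * m) : ℝ) / (Nat.factorial (2 * m - 2 * i) : ℝ)) *
      ((2 : ℝ) ^ i / (Nat.factorial (i + 1) : ℝ)) * Yrec 4 0 (2 * m - 2 * i) (d - i) := by
  refine le_of_le_of_eq (card_doubleNoncrossing_le (β := Fin d)
    (W := fun A k => ∀ b, k b = 0 ∨ 4 ≤ k b)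
    (fun i => Yrec 4 0 (2 * m - 2 * i) (d - i)) ?_ _ ?_) (by rw [Fintype.card_fin])
  · intro A S hS
    have h := Yrec_zero_eq_card (α := {t // t ∉ S}) (β := {b // b ∉ A}) (p := 4) (by omega)
    simp only [card_notMem_finset, Fintype.card_fin, hS] at h
    rw [h, Nat.cast_inj]
    exact card_filter_univ_congr fun g => Iff.rfl
  · intro ω hω
    simp only [mem_filter, mem_univ, true_and] at hω
    obtain ⟨hY, hN, h3⟩ := hω
    refine ⟨hY.doubleLetters_nonempty, hN, fun b => ?_⟩
    have h1 := hY.occ_eq_zero_or b.2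
    have h2 : occ ω b ≠ 3 := fun hb => h3 ⟨b, hb⟩
    change occ ω b = 0 ∨ 4 ≤ occ ω b
    omega

theorem wordProd_smul_eq_iff {k d L : ℕ} (c : Fin d) (ω : Fin L → Fin d)
    (s : Fin d → GL (Fin k) (ZMod 2)) (v : NonzeroVec k) :
    wordProd (extendWord c ω) (fun t => decide (t % 2 = 0)) L s • v = v ↔
      (((List.ofFn fun i : Fin L => if (i : ℕ) % 2 = 0 then s (ω i) else (s (ω i))⁻¹).reverse.prod :
        GL (Fin k) (ZMod 2)) : Matrix (Fin k) (Fin k) (ZMod 2)).mulVec v.1 = v.1 := by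
  have h : (fun i : Fin L => if (i : ℕ) % 2 = 0 then s (ω i) else (s (ω i))⁻¹) =
      fun i : Fin L => signed (decide ((i : ℕ) % 2 = 0)) (s (extendWord c ω i)) := by
    funext i
    simp [signed, extendWord_coe]
  rw [h, ofFn_reverse_prod_eq_walkProd
    (fun t => signed (decide (t % 2 = 0)) (s (extendWord c ω t))), Subtype.ext_iff,
    NonzeroVec.coe_smul]
  rfl

end Assembly

/-- Let `k ≥ 2`, `n = 2^k − 1`, and `d, m` positive. Let `s₁,…,s_d` be
independent uniform random elements of `GL_k(F₂)`, let `ω = (j₁,…,j_{2m})` be a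
uniformly random word over `{1,…,d}`, independent from the matrices, and fix a nonzero
`v₁ ∈ F₂^k`; the walk applies alternately `s_{j₁}, s_{j₂}⁻¹, s_{j₃}, …, s_{j_{2m}}⁻¹`.
With `y₃(i) = Y₃(1, 2m−2i, d−i)`, `y₄(i) = Y₄(0, 2m−2i, d−i)`,
`P(walk returns to v₁ ∧ ω ∈ Y₂) ≤ (1/d)^{2m}·[Y₂(1,2m,d)·(2/n)
  + Σ_{i=1}^{m} C(d,i)·(1/2)^i·((2m)!/(2m−2i)!)·(2^i/(i+1)!)·(y₃(i)·(5/n) + y₄(i))]`. -/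
theorem stmt15
    {k n d m : ℕ} (hk : 2 ≤ k) (hn : n = 2 ^ k - 1) (hd : 0 < d) (hm : 0 < m)
    (v₁ : Fin k → ZMod 2) (hv₁ : v₁ ≠ 0) :
    (Nat.card {p : (Fin (2 * m) → Fin d) × (Fin d → GL (Fin k) (ZMod 2)) //
        (((List.ofFn fun i : Fin (2 * m) =>
            if (i : ℕ) % 2 = 0 then p.2 (p.1 i) else (p.2 (p.1 i))⁻¹).reverse.prod :
              GL (Fin k) (ZMod 2)) :
            Matrix (Fin k) (Fin k) (ZMod 2)).mulVec v₁ = v₁ ∧ memY2 p.1} : ℝ)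
      / ((d : ℝ) ^ (2 * m) * (Nat.card (GL (Fin k) (ZMod 2)) : ℝ) ^ d)
    ≤ (1 / (d : ℝ)) ^ (2 * m) *
        (Yrec 2 1 (2 * m) d * (2 / n)
          + ∑ i ∈ Finset.Icc 1 m, (d.choose i : ℝ) * ((1 : ℝ) / 2) ^ i *
            ((Nat.factorial (2 * m) : ℝ) / (Nat.factorial (2 * m - 2 * i) : ℝ)) *
            ((2 : ℝ) ^ i / (Nat.factorial (i + 1) : ℝ)) *
            (Yrec 3 1 (2 * m - 2 * i) (d - i) * (5 / n)
              + Yrec 4 0 (2 * m - 2 * i) (d - i))) := by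
  classical
  subst hn
  let v : NonzeroVec k := ⟨v₁, hv₁⟩
  let c : Fin d := ⟨0, hd⟩
  let N : (Fin (2 * m) → Fin d) → ℕ := fun ω =>
    Nat.card {s : Fin d → GL (Fin k) (ZMod 2) //
      wordProd (extendWord c ω) (fun t => decide (t % 2 = 0)) (2 * m) s • v = v}
  have hcount : Nat.card {p : (Fin (2 * m) → Fin d) × (Fin d → GL (Fin k) (ZMod 2)) //
        (((List.ofFn fun i : Fin (2 * m) =>
            if (i : ℕ) % 2 = 0 then p.2 (p.1 i) else (p.2 (p.1 i))⁻¹).reverse.prod :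
              GL (Fin k) (ZMod 2)) :
            Matrix (Fin k) (Fin k) (ZMod 2)).mulVec v₁ = v₁ ∧ memY2 p.1} =
      ∑ ω with memY2 ω, N ω := by
    rw [Nat.card_eq_fintype_card, Fintype.card_subtype, Finset.card_filter, Fintype.sum_prod_type,
      Finset.sum_filter]
    refine Finset.sum_congr rfl fun ω _ => ?_
    split_ifs with hω
    · simp only [N, Nat.card_eq_fintype_card, Fintype.card_subtype, Finset.card_filter]
      refine Finset.sum_congr rfl fun s _ => ?_
      simp only [wordProd_smul_eq_iff c ω s v, hω, and_true, v]
    · simp [hω]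
  rw [hcount]
  have hn : (0 : ℝ) < Fintype.card (NonzeroVec k) := by
    have : Nonempty (NonzeroVec k) := ⟨v⟩
    exact_mod_cast Fintype.card_pos
  have hG : (0 : ℝ) < (Nat.card (GL (Fin k) (ZMod 2)) : ℝ) ^ d := by
    have : 0 < Nat.card (GL (Fin k) (ZMod 2)) := Nat.card_pos
    positivity
  have hd' : (0 : ℝ) < (d : ℝ) ^ (2 * m) := by positivity
  have hX : 3 ≤ Fintype.card (NonzeroVec k) := by
    rw [NonzeroVec.card]
    have := Nat.pow_le_pow_right (show 0 < 2 by omega) hk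
    omega
  have hX' : Fintype.card (NonzeroVec k) ≤ 7 ∨ 15 ≤ Fintype.card (NonzeroVec k) := by
    rw [NonzeroVec.card]
    rcases Nat.lt_or_ge k 4 with hk4 | hk4
    · have := Nat.pow_le_pow_right (show 0 < 2 by omega) (show k ≤ 3 by omega)
      omega
    · have := Nat.pow_le_pow_right (show 0 < 2 by omega) hk4
      omega
  let Y : Finset (Fin (2 * m) → Fin d) := Finset.univ.filter fun ω => memY2 ω
  let Ω₃ : Finset (Fin (2 * m) → Fin d) := Finset.univ.filter fun ω =>
    memY2 ω ∧ DoubleNoncrossing ω ∧ ∃ b, occ ω b = 3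
  let Ω₄ : Finset (Fin (2 * m) → Fin d) := Finset.univ.filter fun ω =>
    memY2 ω ∧ DoubleNoncrossing ω ∧ ¬ ∃ b, occ ω b = 3
  have h2 : Yrec 2 1 (2 * m) d = Y.card := Yrec_two_one_eq_card
  have h3 : (Ω₃.card : ℝ) ≤ _ := card_doubleNoncrossing_three_le
  have h4 : (Ω₄.card : ℝ) ≤ _ := card_doubleNoncrossing_not_three_le
  have hsum : ∑ ω ∈ Y, (Fintype.card (NonzeroVec k) : ℝ) * N ω ≤
      ∑ ω ∈ Y, (2 + ((if ω ∈ Ω₃ then 5 else 0) +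
        if ω ∈ Ω₄ then (Fintype.card (NonzeroVec k) : ℝ) else 0)) *
          (Nat.card (GL (Fin k) (ZMod 2)) : ℝ) ^ Fintype.card (Fin d) :=
    Finset.sum_le_sum fun ω hω => by
      have hY : memY2 ω := (Finset.mem_filter.1 hω).2
      exact (linearLike_nonzeroVec hk).card_return_le hX hX' c ω (fun t => decide (t % 2 = 0)) v
        (fun h h' => Finset.mem_filter.2 ⟨Finset.mem_univ _, hY, h, h'⟩)
        (fun h h' => Finset.mem_filter.2 ⟨Finset.mem_univ _, hY, h, h'⟩)
  have hY₃ : Y ∩ Ω₃ = Ω₃ := Finset.inter_eq_right.2 fun ω hω =>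
    Finset.mem_filter.2 ⟨Finset.mem_univ _, (Finset.mem_filter.1 hω).2.1⟩
  have hY₄ : Y ∩ Ω₄ = Ω₄ := Finset.inter_eq_right.2 fun ω hω =>
    Finset.mem_filter.2 ⟨Finset.mem_univ _, (Finset.mem_filter.1 hω).2.1⟩
  rw [← Finset.mul_sum, ← Finset.sum_mul, Fintype.card_fin, Finset.sum_add_distrib,
    Finset.sum_add_distrib, Finset.sum_const, Finset.sum_ite_mem, Finset.sum_ite_mem, hY₃, hY₄,
    Finset.sum_const, Finset.sum_const, nsmul_eq_mul, nsmul_eq_mul, nsmul_eq_mul, ← h2] at hsum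
  rw [← NonzeroVec.card k]
  simp only [mul_add _ (Yrec 3 1 _ _ * _), Finset.sum_add_distrib, ← mul_assoc _ (Yrec 3 1 _ _),
    ← Finset.sum_mul]
  rw [Nat.cast_sum, one_div, inv_pow, inv_mul_eq_div, div_le_div_iff₀ (by positivity) hd']
  have hle := hsum.trans (mul_le_mul_of_nonneg_right (add_le_add_right (add_le_add
    (mul_le_mul_of_nonneg_right h3 (show (0 : ℝ) ≤ 5 by norm_num))
    (mul_le_mul_of_nonneg_right h4 hn.le)) _) hG.le)
  generalize (Fintype.card (NonzeroVec k) : ℝ) = n at *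
  generalize (Nat.card (GL (Fin k) (ZMod 2)) : ℝ) ^ d = g at *
  generalize (d : ℝ) ^ (2 * m) = D at *
  have key : ∑ ω ∈ Y, (N ω : ℝ) ≤ _ := (le_div_iff₀' hn).2 hle
  have clear_denom (a b e : ℝ) :
      (a * 2 + (b * 5 + e * n)) * g / n * D = (a * (2 / n) + (b * (5 / n) + e)) * (D * g) := by
    field_simp
  exact (mul_le_mul_of_nonneg_right key hd'.le).trans_eq (clear_denom _ _ _)
end

section
/- Let d, m be positive integers with m ≤ d. Among all (2d)^{2m} words of length 2m over the alphabet {1,…,d}×{±1}, the number of words in which no letter occurs exactly once is at most C(d,m)·(2m)^{2m}; consequently, the fraction of such words is at most C(d,m)·(m/d)^{2m} ≤ (e·m/d)^m, where e is the base of the natural logarithm. -/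
open scoped BigOperators

/-- A function on a `2m`-element type none of whose fibres is a singleton has its range inside
some `m`-element set. -/
lemma exists_card_eq_forall_mem_of_card_fiber_ne_one {ι α : Type*} [Fintype ι] [Fintype α]
    [DecidableEq α] {m : ℕ} (hι : Fintype.card ι = 2 * m) (hα : m ≤ Fintype.card α) (f : ι → α)
    (hf : ∀ a, (Finset.univ.filter fun i => f i = a).card ≠ 1) :
    ∃ S : Finset α, S.card = m ∧ ∀ i, f i ∈ S := by
  have himage : 2 * (Finset.univ.image f).card ≤ (Finset.univ : Finset ι).card := by
    refine Finset.mul_card_image_le_card Finset.univ 2 fun a ha => ?_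
    obtain ⟨i, -, hi⟩ := Finset.mem_image.1 ha
    have hpos : 0 < (Finset.univ.filter fun i => f i = a).card :=
      Finset.card_pos.2 ⟨i, by simpa using hi⟩
    have hne := hf a
    omega
  rw [Finset.card_univ, hι] at himage
  obtain ⟨S, hS, hcard⟩ := Finset.exists_superset_card_eq
    (show (Finset.univ.image f).card ≤ m by omega) hα
  exact ⟨S, hcard, fun i => hS (Finset.mem_image_of_mem f (Finset.mem_univ i))⟩

lemma card_words_no_letter_once_le {d m : ℕ} (hmd : m ≤ d) :
    Nat.card {w : Fin (2 * m) → Fin d × Bool //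
        ∀ j : Fin d, (Finset.univ.filter fun i : Fin (2 * m) => (w i).1 = j).card ≠ 1}
      ≤ d.choose m * (2 * m) ^ (2 * m) := by
  rw [Nat.card_eq_fintype_card, Fintype.card_subtype]
  calc _ ≤ ((Finset.powersetCard m (Finset.univ : Finset (Fin d))).biUnion fun S =>
          Fintype.piFinset fun _ : Fin (2 * m) => S ×ˢ (Finset.univ : Finset Bool)).card := by
        refine Finset.card_le_card fun w hw => ?_
        obtain ⟨S, hS, hmem⟩ := exists_card_eq_forall_mem_of_card_fiber_ne_one
          (Fintype.card_fin (2 * m))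
          (by simpa using hmd) (fun i => (w i).1) (Finset.mem_filter.1 hw).2
        simpa [Finset.mem_powersetCard] using ⟨S, hS, hmem⟩
    _ ≤ (Finset.powersetCard m (Finset.univ : Finset (Fin d))).card * (2 * m) ^ (2 * m) := by
        refine Finset.card_biUnion_le_card_mul _ _ _ fun S hS => ?_
        simp [(Finset.mem_powersetCard.1 hS).2, mul_comm]
    _ = d.choose m * (2 * m) ^ (2 * m) := by simp

lemma choose_mul_div_pow_le_exp_mul_div_pow {d : ℕ} (m : ℕ) (hd : 0 < d) :
    (d.choose m : ℝ) * ((m : ℝ) / d) ^ (2 * m) ≤ (Real.exp 1 * m / d) ^ m := by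
  have hd' : (d : ℝ) ≠ 0 := by positivity
  have hexp : (m : ℝ) ^ m / m.factorial ≤ Real.exp 1 ^ m := by
    rw [← Real.exp_nat_mul, mul_one]
    exact Real.pow_div_factorial_le_exp _ m.cast_nonneg m
  calc (d.choose m : ℝ) * ((m : ℝ) / d) ^ (2 * m)
      ≤ (d : ℝ) ^ m / m.factorial * ((m : ℝ) / d) ^ (2 * m) := by
        gcongr
        exact Nat.choose_le_pow_div m d
    _ = (m : ℝ) ^ m / m.factorial * ((m : ℝ) / d) ^ m := by
        rw [two_mul, pow_add, div_pow]
        field_simp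
    _ ≤ Real.exp 1 ^ m * ((m : ℝ) / d) ^ m := by gcongr
    _ = (Real.exp 1 * m / d) ^ m := by rw [← mul_pow, mul_div_assoc]

/-- Let `d, m` be positive integers with `m ≤ d`. Among all
`(2d)^{2m}` signed words of length `2m` over `d` letters, the number of words in which
no letter occurs exactly once is at most `C(d,m)·(2m)^{2m}`; consequently the fraction
of such words is at most `C(d,m)·(m/d)^{2m} ≤ (e·m/d)^m`. -/
theorem stmt18
    {d m : ℕ} (hd : 0 < d) (hm : 0 < m) (hmd : m ≤ d) :
    (Nat.card {w : Fin (2 * m) → Fin d × Bool //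
        ∀ j : Fin d, (Finset.univ.filter fun i : Fin (2 * m) => (w i).1 = j).card ≠ 1}
      ≤ d.choose m * (2 * m) ^ (2 * m)) ∧
    ((Nat.card {w : Fin (2 * m) → Fin d × Bool //
        ∀ j : Fin d, (Finset.univ.filter fun i : Fin (2 * m) => (w i).1 = j).card ≠ 1} : ℝ)
        / (2 * d : ℝ) ^ (2 * m)
      ≤ (d.choose m : ℝ) * ((m : ℝ) / d) ^ (2 * m)) ∧
    ((d.choose m : ℝ) * ((m : ℝ) / d) ^ (2 * m)
      ≤ (Real.exp 1 * m / d) ^ m) := by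
  refine ⟨card_words_no_letter_once_le hmd, ?_, choose_mul_div_pow_le_exp_mul_div_pow m hd⟩
  have hd' : (0 : ℝ) < d := by exact_mod_cast hd
  rw [div_le_iff₀ (by positivity), mul_assoc, ← mul_pow,
    show (m : ℝ) / d * (2 * d) = 2 * m by field_simp]
  exact_mod_cast card_words_no_letter_once_le hmd
end

section
/- Let d, m be positive integers. The number of sequences ((j₁,ε₁),…,(j_{2m},ε_{2m})) with j_i ∈ {1,…,d} and ε_i ∈ {±1} such that the product x_{j₁}^{ε₁}·x_{j₂}^{ε₂}⋯x_{j_{2m}}^{ε_{2m}} equals the identity element of the free group on generators x₁,…,x_d is at most C(2m+1, m)·(2d)^m/(2m+1); consequently, the fraction of such sequences among all (2d)^{2m} sequences is at most (2/d)^m. -/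
open scoped BigOperators

namespace FreeGroup

variable {α : Type*}

/-- A word reducing to a single letter `y` splits at an occurrence of `y` into two words that
both reduce to the empty word. -/
theorem Red.exists_append_cons_of_singleton {L : List (α × Bool)} {y : α × Bool}
    (h : Red L [y]) : ∃ u v, L = u ++ y :: v ∧ Red u [] ∧ Red v [] := by
  induction h using Relation.ReflTransGen.head_induction_on with
  | refl => exact ⟨[], [], rfl, Red.refl, Red.refl⟩
  | head hstep _ ih =>
    obtain ⟨u, v, huv, hu, hv⟩ := ih
    obtain @⟨L₁, L₂, x, b⟩ := hstep
    rcases List.append_eq_append_iff.mp huv with ⟨s, rfl, rfl⟩ | ⟨s, rfl, hs⟩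
    · exact ⟨L₁ ++ (x, b) :: (x, !b) :: s, v, by simp, .head Red.Step.not hu, hv⟩
    · cases s with
      | nil =>
        obtain rfl : y :: v = L₂ := hs
        refine ⟨u ++ (x, b) :: (x, !b) :: [], v, by simp, .head Red.Step.not ?_, hv⟩
        rw [List.append_nil]
        exact hu
      | cons z s =>
        obtain ⟨rfl, rfl⟩ := List.cons.inj hs
        exact ⟨u, s ++ (x, b) :: (x, !b) :: L₂, by simp, hu, .head Red.Step.not hv⟩

theorem Red.even_length_of_nil {L : List (α × Bool)} (h : Red L []) : Even L.length := by
  obtain ⟨n, hn⟩ := Red.length h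
  exact ⟨n, by simpa [two_mul] using hn⟩

theorem prod_map_signed_of (L : List (α × Bool)) :
    (L.map fun a => if a.2 then of a.1 else (of a.1)⁻¹).prod = mk L := by
  induction L with
  | nil => rfl
  | cons a L ih =>
    obtain ⟨x, b⟩ := a
    rw [List.map_cons, List.prod_cons, ih]
    cases b <;> simp [of, inv_mk, invRev]

theorem finite_setOf_length_eq_and_red_nil (α : Type*) [Finite α] (n : ℕ) :
    {L : List (α × Bool) | L.length = 2 * n ∧ Red L []}.Finite :=
  (List.finite_length_eq (α × Bool) (2 * n)).subset fun _ h => h.1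

/-- The words of length `2 * n` that reduce to the empty word. -/
noncomputable def trivialWords (α : Type*) [Finite α] (n : ℕ) : Finset (List (α × Bool)) :=
  (finite_setOf_length_eq_and_red_nil α n).toFinset

@[simp]
theorem mem_trivialWords [Finite α] {n : ℕ} {L : List (α × Bool)} :
    L ∈ trivialWords α n ↔ L.length = 2 * n ∧ Red L [] := by
  simp [trivialWords]

open Classical in
theorem trivialWords_succ_subset [Fintype α] (n : ℕ) :
    trivialWords α (n + 1) ⊆ (Finset.HasAntidiagonal.antidiagonal n).biUnion fun ij =>
      (Finset.univ ×ˢ trivialWords α ij.1 ×ˢ trivialWords α ij.2).image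
        fun t => t.1 :: (t.2.1 ++ (t.1.1, !t.1.2) :: t.2.2) := by
  intro L hL
  obtain ⟨hlen, hred⟩ := mem_trivialWords.mp hL
  cases L with
  | nil => simp at hlen
  | cons a L =>
    obtain ⟨x, b⟩ := a
    obtain ⟨u, v, rfl, hu, hv⟩ :=
      (Red.cons_nil_iff_singleton.mp hred).exists_append_cons_of_singleton
    obtain ⟨i, hi⟩ := hu.even_length_of_nil
    obtain ⟨j, hj⟩ := hv.even_length_of_nil
    simp only [List.length_cons, List.length_append] at hlen
    refine Finset.mem_biUnion.mpr ⟨(i, j), Finset.HasAntidiagonal.mem_antidiagonal.mpr (by omega), ?_⟩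
    refine Finset.mem_image.mpr ⟨((x, b), u, v), ?_, rfl⟩
    simp only [Finset.mem_product, Finset.mem_univ, mem_trivialWords, true_and]
    exact ⟨⟨by omega, hu⟩, by omega, hv⟩

theorem card_trivialWords_le [Fintype α] (n : ℕ) :
    (trivialWords α n).card ≤ catalan n * (2 * Fintype.card α) ^ n := by
  classical
  induction n using Nat.strong_induction_on with
  | _ n ih =>
    cases n with
    | zero =>
      have h : trivialWords α 0 ⊆ {[]} := fun L hL => by
        simpa using (mem_trivialWords.mp hL).1
      simpa using Finset.card_le_card h
    | succ n =>
      calc (trivialWords α (n + 1)).card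
          ≤ ∑ ij ∈ Finset.HasAntidiagonal.antidiagonal n, 2 * Fintype.card α *
              ((trivialWords α ij.1).card * (trivialWords α ij.2).card) := by
            refine (Finset.card_le_card (trivialWords_succ_subset n)).trans
              (Finset.card_biUnion_le.trans (Finset.sum_le_sum fun ij _ => ?_))
            refine Finset.card_image_le.trans_eq ?_
            simp [Finset.card_product, mul_comm]
        _ ≤ ∑ ij ∈ Finset.HasAntidiagonal.antidiagonal n,
              catalan ij.1 * catalan ij.2 * (2 * Fintype.card α) ^ (n + 1) := by
            refine Finset.sum_le_sum fun ij hij => ?_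
            have hij := Finset.HasAntidiagonal.mem_antidiagonal.mp hij
            calc _ ≤ 2 * Fintype.card α * ((catalan ij.1 * (2 * Fintype.card α) ^ ij.1) *
                    (catalan ij.2 * (2 * Fintype.card α) ^ ij.2)) := by
                  gcongr
                  · exact ih _ (by omega)
                  · exact ih _ (by omega)
              _ = _ := by rw [← hij]; ring
        _ = catalan (n + 1) * (2 * Fintype.card α) ^ (n + 1) := by
            rw [catalan_succ', Finset.sum_mul]

theorem card_signed_prod_eq_one_le [Fintype α] (n : ℕ) :
    Nat.card {w : Fin (2 * n) → α × Bool //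
        (List.ofFn fun i : Fin (2 * n) =>
          if (w i).2 then of (w i).1 else (of (w i).1)⁻¹).prod = 1}
      ≤ catalan n * (2 * Fintype.card α) ^ n := by
  refine le_trans ?_ (card_trivialWords_le n)
  rw [← Nat.card_eq_finsetCard]
  refine Nat.card_le_card_of_injective
    (fun w => ⟨List.ofFn w.1, mem_trivialWords.mpr ⟨List.length_ofFn, ?_⟩⟩) fun w w' h => ?_
  · have hw := w.2
    rw [← Function.comp_def (fun a : α × Bool => if a.2 then of a.1 else (of a.1)⁻¹) w.1,
      ← List.map_ofFn, prod_map_signed_of] at hw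
    obtain ⟨L, hL, hnil⟩ := Red.exact.mp (hw.trans one_eq_mk)
    rwa [Red.nil_iff.mp hnil] at hL
  · exact Subtype.ext (List.ofFn_injective (congrArg Subtype.val h))

end FreeGroup

theorem catalan_mul_two_mul_add_one (n : ℕ) :
    catalan n * (2 * n + 1) = (2 * n + 1).choose n := by
  have h := Nat.add_one_mul_choose_eq (2 * n) n
  rw [Nat.choose_symm_half, ← Nat.centralBinom_eq_two_mul_choose,
    ← succ_mul_catalan_eq_centralBinom] at h
  exact Nat.eq_of_mul_eq_mul_right n.succ_pos (by linarith)

theorem catalan_le_four_pow (n : ℕ) : catalan n ≤ 4 ^ n :=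
  calc catalan n ≤ (n + 1) * catalan n := Nat.le_mul_of_pos_left _ n.succ_pos
    _ = (2 * n).choose n := by
      rw [succ_mul_catalan_eq_centralBinom, Nat.centralBinom_eq_two_mul_choose]
    _ ≤ 2 ^ (2 * n) := Nat.choose_le_two_pow _ _
    _ = 4 ^ n := by rw [pow_mul]; norm_num

/-- Let `d, m` be positive integers. The number of signed sequences
`((j₁,ε₁),…,(j_{2m},ε_{2m}))` whose product `x_{j₁}^{ε₁}⋯x_{j_{2m}}^{ε_{2m}}` is the
identity of the free group on `x₁,…,x_d` is at most `C(2m+1, m)·(2d)^m/(2m+1)`;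
consequently the fraction of such sequences among all `(2d)^{2m}` is at most
`(2/d)^m`. -/
theorem stmt19
    {d m : ℕ} (hd : 0 < d) (hm : 0 < m) :
    (Nat.card {w : Fin (2 * m) → Fin d × Bool //
        (List.ofFn fun i : Fin (2 * m) =>
          if (w i).2 then FreeGroup.of (w i).1 else (FreeGroup.of (w i).1)⁻¹).prod = 1}
        * (2 * m + 1)
      ≤ (2 * m + 1).choose m * (2 * d) ^ m) ∧
    ((Nat.card {w : Fin (2 * m) → Fin d × Bool //
        (List.ofFn fun i : Fin (2 * m) =>
          if (w i).2 then FreeGroup.of (w i).1 else (FreeGroup.of (w i).1)⁻¹).prod = 1} : ℝ)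
        / (2 * d : ℝ) ^ (2 * m)
      ≤ ((2 : ℝ) / d) ^ m) := by
  have hcard := FreeGroup.card_signed_prod_eq_one_le (α := Fin d) m
  rw [Fintype.card_fin] at hcard
  refine ⟨?_, ?_⟩
  · rw [← catalan_mul_two_mul_add_one, mul_right_comm]
    gcongr
  · have hd' : (0 : ℝ) < d := by exact_mod_cast hd
    rw [div_le_iff₀ (by positivity)]
    calc _ ≤ ((4 ^ m * (2 * d) ^ m : ℕ) : ℝ) := by
          exact_mod_cast hcard.trans (Nat.mul_le_mul_right _ (catalan_le_four_pow m))
      _ = (2 / d : ℝ) ^ m * (2 * d) ^ (2 * m) := by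
          push_cast
          rw [pow_mul, ← mul_pow, ← mul_pow]
          congr 1
          field_simp
          ring
end
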